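/- arXiv:1112.0940 — 10 statements merged into one kernel-verified Lean document; each statement's English description precedes it below -/
import Mathlib

section
/- Let a_0, …, a_d be positive integers, let n = a_0 + ⋯ + a_d, and let k be the smallest positive integer such that k divides d+1 and a_i = a_{i+k} for all 0 ≤ i ≤ d−k. Then the difference cycle (a_0 : ⋯ : a_d) has length a_0 + a_1 + ⋯ + a_{k−1}, and this number equals n·k/(d+1). -/
/-- The representative set `{0, a 0, a 0 + a 1, …, a 0 + ⋯ + a (d-1)}` of a difference cycle
of dimension `d` on `n` vertices, as a finset of `ZMod n`. -/
def repSet (n d : ℕ) (a : ℕ → ℕ) : Finset (ZMod n) :=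
  (Finset.range (d + 1)).image fun j => ((∑ i ∈ Finset.range j, a i : ℕ) : ZMod n)

/-- The difference cycle `(a 0 : … : a d)` on `n` vertices: the orbit of the representative
set under the translation `v ↦ v + 1` of `ZMod n`. -/
def diffCycle (n d : ℕ) (a : ℕ → ℕ) : Set (Finset (ZMod n)) :=
  { G | ∃ t : ZMod n, G = (repSet n d a).image fun x => t + x }

open scoped Pointwise

lemma Function.Periodic.sum_range_add_mul {b : ℕ → ℕ} {p : ℕ} (hb : Function.Periodic b p)
    (j q : ℕ) :
    ∑ i ∈ Finset.range (j + q * p), b i =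
      ∑ i ∈ Finset.range j, b i + q * ∑ i ∈ Finset.range p, b i := by
  induction q with
  | zero => simp
  | succ q ih =>
    have h : j + (q + 1) * p = p + (j + q * p) := by ring
    have hb' : ∀ i, b (p + i) = b i := fun i => by rw [add_comm, hb]
    rw [h, Finset.sum_range_add]
    simp only [hb', ih]
    ring

lemma Function.Periodic.nat_gcd {α : Type*} {b : ℕ → α} (p q : ℕ) (hp : Function.Periodic b p)
    (hq : Function.Periodic b q) : Function.Periodic b (p.gcd q) := by
  induction p, q using Nat.gcd.induction with
  | H0 q => simpa using hq
  | H1 p q _ ih =>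
    rw [Nat.gcd_rec]
    refine ih (fun i => ?_) hp
    rw [← hp.nat_mul (q / p) (i + q % p)]
    rw [Nat.cast_id, add_assoc, mul_comm, Nat.mod_add_div, hq]

lemma strictMono_sum_range {b : ℕ → ℕ} (hpos : ∀ i, 0 < b i) :
    StrictMono fun j => ∑ i ∈ Finset.range j, b i :=
  strictMono_nat_of_lt_succ fun j => by
    simpa only [Finset.sum_range_succ] using Nat.lt_add_of_pos_right (hpos j)

/-- If the set of partial sums of a positive sequence is invariant under translation by `t`, then
`t` is a partial sum over a period. -/
lemma exists_periodic_of_partialSums_invariant {b : ℕ → ℕ} (hpos : ∀ i, 0 < b i) {t : ℕ}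
    (h : ∀ x, (∃ j, ∑ i ∈ Finset.range j, b i = t + x) ↔ ∃ j, ∑ i ∈ Finset.range j, b i = x) :
    ∃ r, Function.Periodic b r ∧ ∑ i ∈ Finset.range r, b i = t := by
  have hS := strictMono_sum_range hpos
  set S : ℕ → ℕ := fun j => ∑ i ∈ Finset.range j, b i with hSdef
  have hsucc : ∀ j, S (j + 1) = S j + b j := fun j => Finset.sum_range_succ b j
  change ∀ x, (∃ j, S j = t + x) ↔ ∃ j, S j = x at h
  obtain ⟨r, hr⟩ := (h 0).2 ⟨0, by simp [hSdef]⟩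
  have key : ∀ j, S (j + r) = t + S j := by
    intro j
    induction j with
    | zero => simpa [hSdef] using hr
    | succ j ih =>
      have e : j + 1 + r = j + r + 1 := by ring
      have h1 := hsucc j
      have h2 := hsucc (j + r)
      have p1 := hpos j
      have p2 := hpos (j + r)
      rw [e]
      apply le_antisymm
      · obtain ⟨u, hu⟩ := (h (S (j + 1))).2 ⟨_, rfl⟩
        have : j + r < u := hS.lt_iff_lt.1 (show S (j + r) < S u by omega)
        exact hu ▸ hS.monotone this
      · obtain ⟨v, hv⟩ := (h (S (j + r + 1) - t)).1 ⟨j + r + 1, by omega⟩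
        have : j < v := hS.lt_iff_lt.1 (show S j < S v by omega)
        have : S (j + 1) ≤ S v := hS.monotone this
        omega
  refine ⟨r, fun j => ?_, by simpa using hr⟩
  have e : j + 1 + r = j + r + 1 := by ring
  have h1 := key j
  have h2 := key (j + 1)
  rw [e, hsucc, hsucc] at h2
  omega

lemma natCast_mem_repSet_iff {n d : ℕ} {b : ℕ → ℕ} (hpos : ∀ i, 0 < b i)
    (hb : Function.Periodic b (d + 1)) (hn : n = ∑ i ∈ Finset.range (d + 1), b i) (x : ℕ) :
    (x : ZMod n) ∈ repSet n d b ↔ ∃ j, ∑ i ∈ Finset.range j, b i = x := by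
  simp only [repSet, Finset.mem_image, Finset.mem_range]
  constructor
  · rintro ⟨j, hj, hjx⟩
    have hlt : ∑ i ∈ Finset.range j, b i < n := hn ▸ strictMono_sum_range hpos hj
    rw [ZMod.natCast_eq_natCast_iff', Nat.mod_eq_of_lt hlt] at hjx
    refine ⟨j + x / n * (d + 1), ?_⟩
    rw [hb.sum_range_add_mul, ← hn, hjx, mul_comm, Nat.mod_add_div]
  · rintro ⟨j, rfl⟩
    refine ⟨j % (d + 1), Nat.mod_lt _ d.succ_pos, ?_⟩
    conv_rhs => rw [← Nat.mod_add_div' j (d + 1), hb.sum_range_add_mul, ← hn]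
    simp

lemma natCast_vadd_repSet_eq_iff {n d k : ℕ} {b : ℕ → ℕ} (hpos : ∀ i, 0 < b i)
    (hb : Function.Periodic b (d + 1)) (hn : n = ∑ i ∈ Finset.range (d + 1), b i)
    (hbk : Function.Periodic b k) (hmin : ∀ r, Function.Periodic b r → k ∣ r) (t : ℕ) :
    (t : ZMod n) +ᵥ repSet n d b = repSet n d b ↔ ∑ i ∈ Finset.range k, b i ∣ t := by
  have hmem := natCast_mem_repSet_iff hpos hb hn
  constructor
  · intro h
    obtain ⟨r, hr, rfl⟩ := exists_periodic_of_partialSums_invariant hpos (t := t) fun x => by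
      rw [← hmem, ← hmem, Nat.cast_add, ← vadd_eq_add]
      nth_rw 1 [← h]
      exact Finset.vadd_mem_vadd_finset_iff _
    obtain ⟨q, rfl⟩ := hmin r hr
    have := hbk.sum_range_add_mul 0 q
    rw [zero_add, mul_comm] at this
    simp [this]
  · rintro ⟨q, rfl⟩
    refine Finset.eq_of_subset_of_card_le (fun y hy => ?_) (Finset.card_vadd_finset _ _).ge
    obtain ⟨x, hx, rfl⟩ := Finset.mem_vadd_finset.1 hy
    obtain ⟨j, -, rfl⟩ := Finset.mem_image.1 hx
    rw [vadd_eq_add, ← Nat.cast_add, hmem]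
    exact ⟨j + q * k, by rw [hbk.sum_range_add_mul]; ring⟩

lemma ncard_orbit_of_natCast_vadd_eq_iff {n P : ℕ} [NeZero n] (R : Finset (ZMod n))
    (hR : ∀ t : ℕ, (t : ZMod n) +ᵥ R = R ↔ P ∣ t) :
    (AddAction.orbit (ZMod n) R).ncard = P := by
  have hP : 0 < P := Nat.pos_of_dvd_of_pos ((hR n).1 (by simp)) (NeZero.pos n)
  have horbit : AddAction.orbit (ZMod n) R =
      (fun t : ℕ => (t : ZMod n) +ᵥ R) '' (Finset.range P : Set ℕ) := by
    ext G
    constructor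
    · rintro ⟨t, rfl⟩
      refine ⟨t.val % P, by simpa using Nat.mod_lt _ hP, ?_⟩
      have ht : t = ((t.val % P : ℕ) : ZMod n) + ((P * (t.val / P) : ℕ) : ZMod n) := by
        rw [← Nat.cast_add, Nat.mod_add_div, ZMod.natCast_zmod_val]
      change _ = t +ᵥ R
      conv_rhs => rw [ht, add_vadd, (hR _).2 (dvd_mul_right _ _)]
    · rintro ⟨t, -, rfl⟩
      exact ⟨t, rfl⟩
  have hle : ∀ s < P, ∀ t ≤ s, (t : ZMod n) +ᵥ R = (s : ZMod n) +ᵥ R → t = s := by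
    intro s hs t hts h
    obtain ⟨u, rfl⟩ := Nat.exists_eq_add_of_le hts
    rw [Nat.cast_add, add_vadd, vadd_left_cancel_iff] at h
    have := Nat.eq_zero_of_dvd_of_lt ((hR u).1 h.symm) (by omega)
    omega
  rw [horbit, Set.InjOn.ncard_image, Set.ncard_coe_finset, Finset.card_range]
  intro s hs t ht h
  rw [Finset.coe_range, Set.mem_Iio] at hs ht
  rcases le_total s t with hst | hst
  · exact hle t ht s hst h
  · exact (hle s hs t hst h.symm).symm

lemma diffCycle_eq_orbit (n d : ℕ) (a : ℕ → ℕ) :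
    diffCycle n d a = AddAction.orbit (ZMod n) (repSet n d a) :=
  Set.ext fun _ => exists_congr fun _ => eq_comm

/-- Lemma 3.3 (length of a difference cycle): if `k` is the smallest positive divisor of
`d+1` with `a` `k`-periodic on `0,…,d`, then the difference cycle `(a 0 : … : a d)` has
length `a 0 + ⋯ + a (k-1)`, and this number equals `n·k/(d+1)`. -/
theorem length_of_diffCycle (d n k : ℕ) (a : ℕ → ℕ)
    (ha : ∀ i ≤ d, 0 < a i)
    (hn : n = ∑ i ∈ Finset.range (d + 1), a i)
    (hk : 0 < k) (hkd : k ∣ d + 1)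
    (hper : ∀ i, i + k ≤ d → a (i + k) = a i)
    (hmin : ∀ k', 0 < k' → k' ∣ d + 1 → (∀ i, i + k' ≤ d → a (i + k') = a i) → k ≤ k') :
    (diffCycle n d a).ncard = ∑ i ∈ Finset.range k, a i ∧
      (∑ i ∈ Finset.range k, a i) * (d + 1) = n * k := by
  obtain ⟨q, hq⟩ := hkd
  have hkd' : k ≤ d + 1 := Nat.le_of_dvd d.succ_pos ⟨q, hq⟩
  have hmod : ∀ i ≤ d, a (i % k) = a i := by
    intro i
    induction i using Nat.strong_induction_on with
    | _ i ih =>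
      intro hi
      rcases lt_or_ge i k with h | h
      · rw [Nat.mod_eq_of_lt h]
      · obtain ⟨j, rfl⟩ := Nat.exists_eq_add_of_le' h
        rw [Nat.add_mod_right, ih j (by omega) (by omega), hper j hi]
  set b : ℕ → ℕ := fun i => a (i % k) with hbdef
  have hsum : ∀ j ≤ d + 1, ∑ i ∈ Finset.range j, a i = ∑ i ∈ Finset.range j, b i :=
    fun j hj => Finset.sum_congr rfl fun i hi =>
      (hmod i (by have := Finset.mem_range.1 hi; omega)).symm
  have hrep : repSet n d a = repSet n d b :=
    Finset.image_congr fun j hj => by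
      have := Finset.mem_range.1 hj
      simp only [hsum j (by omega)]
  have hpos : ∀ i, 0 < b i := fun i => ha _ (by have := Nat.mod_lt i hk; omega)
  have hbk : Function.Periodic b k := fun i => by simp [hbdef]
  have hbd : Function.Periodic b (d + 1) := fun i => by simp [hbdef, hq]
  have hmin' : ∀ r, Function.Periodic b r → k ∣ r := by
    intro r hr
    have hg := Function.Periodic.nat_gcd r k hr hbk
    have hle : k ≤ r.gcd k := by
      refine hmin _ (Nat.gcd_pos_of_pos_right _ hk)
        ((Nat.gcd_dvd_right r k).trans ⟨q, hq⟩) fun i hi => ?_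
      rw [← hmod _ hi, ← hmod i (by omega)]
      exact hg i
    exact Nat.gcd_eq_right_iff_dvd.1 (le_antisymm (Nat.gcd_le_right r hk) hle)
  rw [hsum _ le_rfl] at hn
  have hn0 : NeZero n := ⟨by
    have := strictMono_sum_range hpos d.succ_pos
    simp only [Finset.range_zero, Finset.sum_empty] at this
    exact hn ▸ this.ne'⟩
  rw [hsum k hkd', diffCycle_eq_orbit, hrep]
  refine ⟨ncard_orbit_of_natCast_vadd_eq_iff _
    (natCast_vadd_repSet_eq_iff hpos hbd hn hbk hmin'), ?_⟩
  have h := hbk.sum_range_add_mul 0 q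
  rw [zero_add, mul_comm q k, ← hq, ← hn, Finset.range_zero, Finset.sum_empty, zero_add] at h
  rw [h, hq]
  ring
end

section
/- Let a_0, …, a_d be positive integers, let n = a_0 + ⋯ + a_d, let k be a positive integer such that k divides d+1 and a_i = a_{i+k} for all 0 ≤ i ≤ d−k, and set m = a_0 + ⋯ + a_{k−1} (so m = n·k/(d+1)). Then the representative set F = {0, a_0, a_0+a_1, …, a_0+⋯+a_{d−1}} ⊆ ZMod n satisfies m + F = F, i.e. translation by m maps F onto itself. -/
/-- A partial sum of a `k`-periodic sequence may be shifted by any multiple of `k`, as long as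
the shifted indices stay in the range `0,…,d`. -/
theorem sum_range_add_mul_of_periodic {d k : ℕ} {a : ℕ → ℕ}
    (hper : ∀ i, i + k ≤ d → a (i + k) = a i) (q j : ℕ) (hj : k * q + j ≤ d + 1) :
    ∑ i ∈ Finset.range (k * q + j), a i =
      ∑ i ∈ Finset.range (k * q), a i + ∑ i ∈ Finset.range j, a i := by
  have shift : ∀ q i, k * q + i ≤ d → a (k * q + i) = a i := by
    intro q i
    induction q with
    | zero => simp
    | succ q ih =>
      intro h
      rw [Nat.mul_succ, Nat.add_right_comm] at h ⊢
      rw [hper _ h, ih (by omega)]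
  rw [Finset.sum_range_add]
  congr 1
  refine Finset.sum_congr rfl fun i hi => shift q i ?_
  have := Finset.mem_range.1 hi
  omega

/-- If `k` is a positive divisor of `d+1` and `a` is `k`-periodic on `0,…,d`, then
translation by `m = a 0 + ⋯ + a (k-1)` maps the representative set of the difference
cycle `(a 0 : … : a d)` onto itself. -/
theorem translation_fixes_repSet (d n k : ℕ) (a : ℕ → ℕ)
    (ha : ∀ i ≤ d, 0 < a i)
    (hn : n = ∑ i ∈ Finset.range (d + 1), a i)
    (hk : 0 < k) (hkd : k ∣ d + 1)
    (hper : ∀ i, i + k ≤ d → a (i + k) = a i) :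
    (repSet n d a).image
        (fun x => ((∑ i ∈ Finset.range k, a i : ℕ) : ZMod n) + x) = repSet n d a := by
  refine Finset.eq_of_subset_of_card_le ?_
    (Finset.card_image_of_injective _ (add_right_injective _)).ge
  intro y hy
  simp only [repSet, Finset.mem_image, Finset.mem_range, exists_exists_and_eq_and] at hy ⊢
  obtain ⟨j, hj, rfl⟩ := hy
  by_cases h : k + j < d + 1
  · refine ⟨k + j, h, ?_⟩
    have := sum_range_add_mul_of_periodic hper 1 j (by omega)
    rw [mul_one] at this
    rw [this, Nat.cast_add]
  · obtain ⟨q, hq⟩ := hkd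
    obtain ⟨p, rfl⟩ : ∃ p, q = p + 1 := Nat.exists_eq_succ_of_ne_zero (by rintro rfl; omega)
    rw [Nat.mul_succ] at hq
    obtain ⟨r, rfl⟩ : ∃ r, j = k * p + r := Nat.exists_eq_add_of_le (by omega)
    refine ⟨r, by omega, ?_⟩
    have hfull := sum_range_add_mul_of_periodic hper p k hq.ge
    have hpart := sum_range_add_mul_of_periodic hper p r hj.le
    rw [← hq, ← hn] at hfull
    have hzero := congrArg (Nat.cast : ℕ → ZMod n) hfull
    rw [ZMod.natCast_self, Nat.cast_add] at hzero
    rw [hpart, Nat.cast_add, ← add_assoc, add_comm (Nat.cast (∑ i ∈ Finset.range k, a i)),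
      ← hzero, zero_add]
end

section
/- For 1 ≤ i ≤ m let a_i^0, a_i^1, a_i^2, a_i^3 be positive integers with a_i^0 + a_i^1 + a_i^2 + a_i^3 = n and a_i^3 > a_i^0 + a_i^1 + a_i^2. Let M ⊆ Finset (ZMod n) be the union of the difference cycles (a_i^0 : a_i^1 : a_i^2 : a_i^3), and for k ≥ 0 let M_k ⊆ Finset (ZMod (n+k)) be the union of the difference cycles (a_i^0 : a_i^1 : a_i^2 : a_i^3 + k). Define φ_k : ZMod n → ZMod (n+k) by sending the residue with canonical representative v ∈ {0,…,n−1} to v if 2v < n and to v + k if 2v ≥ n. Then φ_k(0) = 0, and the map F ↦ φ_k(F) (image of a finset under φ_k) is a bijection from the set of facets of M containing 0 onto the set of facets of M_k containing 0; in particular it induces a simplicial isomorphism between the link of 0 in M and the link of 0 in M_k, for every k ≥ 0. -/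
/-- The members of a difference cycle containing `0` are the translates of the representative
set by the negatives of its own elements. -/
lemma mem_diffCycle_and_zero_mem_iff {n d : ℕ} {a : ℕ → ℕ} {F : Finset (ZMod n)} :
    F ∈ diffCycle n d a ∧ (0 : ZMod n) ∈ F ↔
      ∃ j ∈ Finset.range (d + 1), F = (Finset.range (d + 1)).image fun l =>
        ((((∑ i ∈ Finset.range l, a i : ℕ) : ℤ) - ((∑ i ∈ Finset.range j, a i : ℕ) : ℤ) : ℤ) :
          ZMod n) := by
  constructor
  · rintro ⟨⟨t, rfl⟩, h0⟩
    simp only [repSet, Finset.image_image, Finset.mem_image, Function.comp_apply] at h0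
    obtain ⟨j, hj, h⟩ := h0
    refine ⟨j, hj, ?_⟩
    rw [repSet, Finset.image_image]
    refine Finset.image_congr fun l _ => ?_
    rw [Function.comp_apply, eq_neg_of_add_eq_zero_left h]
    push_cast
    ring
  · rintro ⟨j, hj, rfl⟩
    refine ⟨⟨-((∑ i ∈ Finset.range j, a i : ℕ) : ZMod n), ?_⟩,
      Finset.mem_image.2 ⟨j, hj, by simp⟩⟩
    rw [repSet, Finset.image_image]
    refine Finset.image_congr fun l _ => ?_
    rw [Function.comp_apply]
    push_cast
    ring

/-- Shifting the residues in the upper half by `k` preserves integers of absolute value less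
than `n / 2`. -/
lemma shift_intCast {n k : ℕ} {φ : ZMod n → ZMod (n + k)}
    (hφ : ∀ x : ZMod n, φ x =
      if 2 * x.val < n then ((x.val : ℕ) : ZMod (n + k)) else ((x.val + k : ℕ) : ZMod (n + k)))
    {z : ℤ} (hz : 2 * |z| < n) : φ (z : ZMod n) = (z : ZMod (n + k)) := by
  have : NeZero n := ⟨by rintro rfl; have := abs_nonneg z; push_cast at hz; omega⟩
  have hval : (((z : ZMod n).val : ℕ) : ℤ) = z % n := ZMod.val_intCast z
  rcases le_or_gt 0 z with h | h
  · rw [abs_of_nonneg h] at hz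
    rw [Int.emod_eq_of_lt h (by omega)] at hval
    rw [hφ, if_pos (by omega), ← Int.cast_natCast, hval]
  · rw [abs_of_neg h] at hz
    rw [← Int.add_emod_right, Int.emod_eq_of_lt (by omega) (by omega)] at hval
    rw [hφ, if_neg (by omega)]
    have hk : (((z : ZMod n).val + k : ℕ) : ℤ) = z + ((n + k : ℕ) : ℤ) := by
      push_cast
      omega
    rw [← Int.cast_natCast, hk, Int.cast_add, Int.cast_natCast, ZMod.natCast_self, add_zero]

/-- Shifting the residues in the upper half by `k` is injective. -/
lemma shift_injective {n k : ℕ} [NeZero n] {φ : ZMod n → ZMod (n + k)}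
    (hφ : ∀ x : ZMod n, φ x =
      if 2 * x.val < n then ((x.val : ℕ) : ZMod (n + k)) else ((x.val + k : ℕ) : ZMod (n + k))) :
    Function.Injective φ := by
  intro x y h
  have hx := x.val_lt
  have hy := y.val_lt
  apply ZMod.val_injective n
  rw [hφ, hφ] at h
  split_ifs at h <;>
  · have h' := congrArg ZMod.val h
    rw [ZMod.val_cast_of_lt (by omega), ZMod.val_cast_of_lt (by omega)] at h'
    omega

/-- Enlarging the last entry of a difference cycle by `k` corresponds, on the members containing
`0`, to taking images under the shift. -/
lemma mem_shifted_diffCycle_iff {n k : ℕ} {a : ℕ → ℕ}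
    (hsum : ∑ j ∈ Finset.range 4, a j = n) (hbig : a 0 + a 1 + a 2 < a 3)
    {φ : ZMod n → ZMod (n + k)}
    (hφ : ∀ x : ZMod n, φ x =
      if 2 * x.val < n then ((x.val : ℕ) : ZMod (n + k)) else ((x.val + k : ℕ) : ZMod (n + k)))
    {G : Finset (ZMod (n + k))} :
    (G ∈ diffCycle (n + k) 3 (fun j => if j = 3 then a 3 + k else a j) ∧ 0 ∈ G) ↔
      ∃ F, (F ∈ diffCycle n 3 a ∧ 0 ∈ F) ∧ F.image φ = G := by
  have hS : ∀ l ∈ Finset.range 4, ∑ i ∈ Finset.range l, (if i = 3 then a 3 + k else a i) =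
      ∑ i ∈ Finset.range l, a i := by
    intro l hl
    refine Finset.sum_congr rfl fun i hi => if_neg ?_
    rw [Finset.mem_range] at hl hi
    omega
  have hle : ∀ l ∈ Finset.range 4, ∑ i ∈ Finset.range l, a i ≤ a 0 + a 1 + a 2 := by
    intro l hl
    refine (Finset.sum_le_sum_of_subset (Finset.range_subset_range.2
      (Nat.le_of_lt_succ (Finset.mem_range.1 hl)))).trans_eq ?_
    simp [Finset.sum_range_succ]
  have key : ∀ j ∈ Finset.range 4,
      ((Finset.range 4).image fun l => ((((∑ i ∈ Finset.range l, a i : ℕ) : ℤ) -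
        ((∑ i ∈ Finset.range j, a i : ℕ) : ℤ) : ℤ) : ZMod n)).image φ =
      (Finset.range 4).image fun l =>
        ((((∑ i ∈ Finset.range l, if i = 3 then a 3 + k else a i : ℕ) : ℤ) -
          ((∑ i ∈ Finset.range j, if i = 3 then a 3 + k else a i : ℕ) : ℤ) : ℤ) :
            ZMod (n + k)) := by
    intro j hj
    rw [Finset.image_image]
    refine Finset.image_congr fun l hl => ?_
    rw [Function.comp_apply, hS l hl, hS j hj]
    apply shift_intCast hφ
    have hl' := hle l hl
    have hj' := hle j hj
    simp only [Finset.sum_range_succ _ 3, Finset.sum_range_succ _ 2, Finset.sum_range_succ _ 1,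
      Finset.sum_range_one] at hsum
    rcases abs_cases (((∑ i ∈ Finset.range l, a i : ℕ) : ℤ) -
      ((∑ i ∈ Finset.range j, a i : ℕ) : ℤ)) with h | h <;> omega
  simp only [mem_diffCycle_and_zero_mem_iff]
  constructor
  · rintro ⟨j, hj, rfl⟩
    exact ⟨_, ⟨j, hj, rfl⟩, key j hj⟩
  · rintro ⟨_, ⟨j, hj, rfl⟩, rfl⟩
    exact ⟨j, hj, key j hj⟩

/-- The key step in Theorem 3.2: if `a i 3 > a i 0 + a i 1 + a i 2` for all `i`, then the
relabeling `φ` (fixing small residues and shifting large ones by `k`) sends the facets of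
`M` containing `0` bijectively onto the facets of `M_k` containing `0`; in particular it
induces a simplicial isomorphism between the links of `0` in `M` and in `M_k`. -/
theorem link_iso_of_shift (m n k : ℕ) (a : Fin m → ℕ → ℕ)
    (hpos : ∀ i, ∀ j ≤ 3, 0 < a i j)
    (hsum : ∀ i, ∑ j ∈ Finset.range 4, a i j = n)
    (hbig : ∀ i, a i 0 + a i 1 + a i 2 < a i 3)
    (φ : ZMod n → ZMod (n + k))
    (hφ : ∀ x : ZMod n, φ x =
      if 2 * x.val < n then ((x.val : ℕ) : ZMod (n + k)) else ((x.val + k : ℕ) : ZMod (n + k))) :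
    φ 0 = 0 ∧
    Set.BijOn (fun F : Finset (ZMod n) => F.image φ)
      {F ∈ ⋃ i, diffCycle n 3 (a i) | (0 : ZMod n) ∈ F}
      {F ∈ ⋃ i, diffCycle (n + k) 3 (fun j => if j = 3 then a i 3 + k else a i j) |
        (0 : ZMod (n + k)) ∈ F} ∧
    Set.BijOn (fun G : Finset (ZMod n) => G.image φ)
      {G | ∃ F ∈ ⋃ i, diffCycle n 3 (a i), (0 : ZMod n) ∈ F ∧ G = F.erase 0}
      {G | ∃ F ∈ ⋃ i, diffCycle (n + k) 3 (fun j => if j = 3 then a i 3 + k else a i j),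
        (0 : ZMod (n + k)) ∈ F ∧ G = F.erase 0} := by
  have hφ0 : φ 0 = 0 := by
    rcases Nat.eq_zero_or_pos n with rfl | hn
    · have hk : (k : ZMod (0 + k)) = 0 := by rw [ZMod.natCast_eq_zero_iff, zero_add]
      simpa [hφ] using hk
    · simpa using shift_intCast hφ (z := 0) (by simpa using hn)
  rcases isEmpty_or_nonempty (Fin m) with hm | ⟨⟨i₀⟩⟩
  · simp [hφ0]
  have : NeZero n := ⟨by
    have h := hsum i₀
    have h0 := hpos i₀ 3 le_rfl
    rw [Finset.sum_range_succ] at h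
    omega⟩
  have hinj := shift_injective hφ
  have hfacets : (fun F : Finset (ZMod n) => F.image φ) ''
      {F ∈ ⋃ i, diffCycle n 3 (a i) | (0 : ZMod n) ∈ F} =
      {F ∈ ⋃ i, diffCycle (n + k) 3 (fun j => if j = 3 then a i 3 + k else a i j) |
        (0 : ZMod (n + k)) ∈ F} := by
    ext G
    simp only [Set.mem_image, Set.mem_ofPred_eq, Set.mem_iUnion, ← exists_and_right,
      mem_shifted_diffCycle_iff (hsum _) (hbig _) hφ]
    exact exists_comm
  have hlink : ∀ {N : ℕ} (A : Set (Finset (ZMod N))),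
      {G | ∃ F ∈ A, (0 : ZMod N) ∈ F ∧ G = F.erase 0} =
        (fun F => F.erase 0) '' {F ∈ A | (0 : ZMod N) ∈ F} := by
    intro N A
    ext G
    simp only [Set.mem_image, Set.mem_ofPred_eq, and_assoc, eq_comm]
  have hinj' := Finset.image_injective hinj
  refine ⟨hφ0, hfacets ▸ hinj'.injOn.bijOn_image, ?_⟩
  rw [hlink, hlink, ← hfacets, Set.image_image]
  simp only [← hφ0, ← Finset.image_erase hinj]
  rw [← Set.image_image (Finset.image φ) fun F : Finset (ZMod n) => F.erase 0]
  exact hinj'.injOn.bijOn_image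
end

section
/- For 1 ≤ i ≤ m let a_i^0, a_i^1, a_i^2, a_i^3 be positive integers with a_i^0 + a_i^1 + a_i^2 + a_i^3 = n, and for k ≥ 0 let M_k ⊆ Finset (ZMod (n+k)) be the union of the difference cycles (a_i^0 : a_i^1 : a_i^2 : a_i^3 + k). Suppose there is an integer k̃ ≥ 0 and an index i with a_i^3 + k̃ = a_i^0 + a_i^1 + a_i^2, while a_j^3 + k̃ ≥ a_j^0 + a_j^1 + a_j^2 for all 1 ≤ j ≤ m. Then the number of vertices of the link of 0 in M_{k̃+1} is strictly greater than the number of vertices of the link of 0 in M_{k̃}, where the vertices of the link of 0 in a complex M on vertex set ZMod N are the elements v ≠ 0 of ZMod N such that {0, v} is contained in some facet of M. -/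
open Finset in
/-- The positive differences of two of the partial sums `∑ x < p, b x` with `p ≤ d`. -/
def posDiffs (d : ℕ) (b : ℕ → ℕ) : Finset ℕ :=
  ((range (d + 1) ×ˢ range (d + 1)).filter fun r => r.1 < r.2).image
    fun r => ∑ x ∈ Ico r.1 r.2, b x

theorem mem_posDiffs {d : ℕ} {b : ℕ → ℕ} {e : ℕ} :
    e ∈ posDiffs d b ↔ ∃ p q, p < q ∧ q ≤ d ∧ ∑ x ∈ Finset.Ico p q, b x = e := by
  simp only [posDiffs, Finset.mem_image, Finset.mem_filter, Finset.mem_product,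
    Finset.mem_range, Prod.exists]
  constructor
  · rintro ⟨p, q, ⟨⟨_, hq⟩, hpq⟩, he⟩
    exact ⟨p, q, hpq, by omega, he⟩
  · rintro ⟨p, q, hpq, hq, he⟩
    exact ⟨p, q, ⟨⟨by omega, by omega⟩, hpq⟩, he⟩

theorem posDiffs_congr {d : ℕ} {b c : ℕ → ℕ} (h : ∀ x < d, b x = c x) :
    posDiffs d b = posDiffs d c := by
  ext e
  simp only [mem_posDiffs]
  refine exists_congr fun p => exists_congr fun q => and_congr_right fun _ =>
    and_congr_right fun hq => ?_
  rw [Finset.sum_congr rfl fun x hx => h x (by have := Finset.mem_Ico.1 hx; omega)]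

/-- Two vertices of a common facet differ by a difference of partial sums. -/
theorem exists_facet_zero_mem_iff {N d : ℕ} {b : ℕ → ℕ} {v : ZMod N} :
    (∃ F ∈ diffCycle N d b, (0 : ZMod N) ∈ F ∧ v ∈ F) ↔
      ∃ p ≤ d, ∃ q ≤ d, v = ((∑ x ∈ Finset.range q, b x : ℕ) : ZMod N) -
        ((∑ x ∈ Finset.range p, b x : ℕ) : ZMod N) := by
  constructor
  · rintro ⟨F, ⟨t, rfl⟩, h0, hv⟩
    simp only [repSet, Finset.mem_image, Finset.mem_range, exists_exists_and_eq_and] at h0 hv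
    obtain ⟨p, hp, h0⟩ := h0
    obtain ⟨q, hq, hv⟩ := hv
    refine ⟨p, by omega, q, by omega, ?_⟩
    rw [← hv, eq_sub_iff_add_eq, add_right_comm, h0, zero_add]
  · rintro ⟨p, hp, q, hq, rfl⟩
    refine ⟨_, ⟨-((∑ x ∈ Finset.range p, b x : ℕ) : ZMod N), rfl⟩, ?_, ?_⟩
    · simp only [repSet, Finset.mem_image, Finset.mem_range, exists_exists_and_eq_and]
      exact ⟨p, by omega, neg_add_cancel _⟩
    · simp only [repSet, Finset.mem_image, Finset.mem_range, exists_exists_and_eq_and]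
      exact ⟨q, by omega, by ring⟩

theorem cast_sum_range_sub {R : Type*} [Ring R] (b : ℕ → ℕ) {p q : ℕ} (h : p ≤ q) :
    ((∑ x ∈ Finset.range q, b x : ℕ) : R) - ((∑ x ∈ Finset.range p, b x : ℕ) : R) =
      ((∑ x ∈ Finset.Ico p q, b x : ℕ) : R) := by
  rw [sub_eq_iff_eq_add, ← Nat.cast_add, add_comm, Finset.sum_range_add_sum_Ico b h]

theorem zmod_natCast_ne_zero {N e : ℕ} (h0 : 0 < e) (h : e < N) : (e : ZMod N) ≠ 0 := by
  rw [Ne, ZMod.natCast_eq_zero_iff]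
  exact fun hd => absurd (Nat.le_of_dvd h0 hd) (by omega)

/-- The vertices of the link of `0` are the positive differences and their negatives. -/
theorem link_vertices_eq {ι : Type*} [Fintype ι] {N d : ℕ} (b : ι → ℕ → ℕ)
    (hb : ∀ i, ∀ e ∈ posDiffs d (b i), 0 < e ∧ e < N) :
    {v : ZMod N | v ≠ 0 ∧ ∃ F ∈ ⋃ i, diffCycle N d (b i), (0 : ZMod N) ∈ F ∧ v ∈ F} =
      (((Finset.univ.biUnion fun i => posDiffs d (b i)).image fun e : ℕ => (e : ZMod N)) ∪
        (Finset.univ.biUnion fun i => posDiffs d (b i)).image fun e : ℕ => -(e : ZMod N) :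
        Finset (ZMod N)) := by
  ext v
  have hswap : (∃ F ∈ ⋃ i, diffCycle N d (b i), (0 : ZMod N) ∈ F ∧ v ∈ F) ↔
      ∃ i, ∃ F ∈ diffCycle N d (b i), (0 : ZMod N) ∈ F ∧ v ∈ F := by
    simp only [Set.mem_iUnion]
    exact ⟨fun ⟨F, ⟨i, hi⟩, h⟩ => ⟨i, F, hi, h⟩, fun ⟨i, F, hi, h⟩ => ⟨F, ⟨i, hi⟩, h⟩⟩
  simp only [Set.mem_ofPred_eq, hswap, exists_facet_zero_mem_iff, Finset.coe_union, Set.mem_union,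
    Finset.mem_coe, Finset.mem_image, Finset.mem_biUnion, Finset.mem_univ, true_and]
  constructor
  · rintro ⟨hv, i, p, hp, q, hq, rfl⟩
    rcases lt_trichotomy p q with h | rfl | h
    · exact Or.inl ⟨_, ⟨i, mem_posDiffs.2 ⟨p, q, h, hq, rfl⟩⟩, (cast_sum_range_sub _ h.le).symm⟩
    · exact absurd (sub_self _) hv
    · refine Or.inr ⟨_, ⟨i, mem_posDiffs.2 ⟨q, p, h, hp, rfl⟩⟩, ?_⟩
      rw [← cast_sum_range_sub _ h.le, neg_sub]
  · rintro (⟨e, ⟨i, hi⟩, rfl⟩ | ⟨e, ⟨i, hi⟩, rfl⟩)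
    all_goals
      obtain ⟨h0, hN⟩ := hb i e hi
      obtain ⟨p, q, hpq, hq, rfl⟩ := mem_posDiffs.1 hi
    · exact ⟨zmod_natCast_ne_zero h0 hN, i, p, by omega, q, hq, (cast_sum_range_sub _ hpq.le).symm⟩
    · refine ⟨neg_ne_zero.2 (zmod_natCast_ne_zero h0 hN), i, q, hq, p, by omega, ?_⟩
      rw [← cast_sum_range_sub _ hpq.le, neg_sub]

theorem card_image_union_image_neg_lt {N : ℕ} (D : Finset ℕ) {e : ℕ} (he : e ∈ D)
    (h2 : 2 * e = N) :
    (D.image (fun x : ℕ => (x : ZMod N)) ∪ D.image fun x : ℕ => -(x : ZMod N)).card < 2 * D.card := by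
  have hneg : -(e : ZMod N) = e := by
    rw [neg_eq_iff_add_eq_zero, ← Nat.cast_add, ← two_mul, h2, ZMod.natCast_self]
  have hsub : (D.image (fun x : ℕ => (x : ZMod N)) ∪ D.image fun x : ℕ => -(x : ZMod N)) ⊆
      D.image (fun x : ℕ => (x : ZMod N)) ∪ (D.erase e).image fun x : ℕ => -(x : ZMod N) := by
    refine Finset.union_subset Finset.subset_union_left fun v hv => ?_
    obtain ⟨x, hx, rfl⟩ := Finset.mem_image.1 hv
    by_cases hxe : x = e
    · subst hxe
      exact Finset.mem_union_left _ (Finset.mem_image.2 ⟨x, hx, hneg.symm⟩)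
    · exact Finset.mem_union_right _
        (Finset.mem_image_of_mem (fun x : ℕ => -(x : ZMod N)) (Finset.mem_erase.2 ⟨hxe, hx⟩))
  have h1 := (Finset.card_le_card hsub).trans (Finset.card_union_le _ _)
  have h3 : (D.image fun x : ℕ => (x : ZMod N)).card ≤ D.card := Finset.card_image_le
  have h4 : ((D.erase e).image fun x : ℕ => -(x : ZMod N)).card ≤ (D.erase e).card :=
    Finset.card_image_le
  have h5 := Finset.card_erase_lt_of_mem he
  omega

theorem card_image_union_image_neg {N : ℕ} (D : Finset ℕ)
    (hD : ∀ e ∈ D, 0 < e ∧ 2 * e < N) :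
    (D.image (fun x : ℕ => (x : ZMod N)) ∪ D.image fun x : ℕ => -(x : ZMod N)).card = 2 * D.card := by
  have hinj : Set.InjOn (fun x : ℕ => (x : ZMod N)) D := by
    intro x hx y hy hxy
    have hx := hD x hx
    have hy := hD y hy
    exact Nat.ModEq.eq_of_lt_of_lt ((ZMod.natCast_eq_natCast_iff _ _ _).1 hxy)
      (by omega) (by omega)
  rw [Finset.card_union_of_disjoint, Finset.card_image_of_injOn hinj,
    Finset.card_image_of_injOn fun x hx y hy hxy => hinj hx hy (neg_injective hxy), two_mul]
  rw [Finset.disjoint_left]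
  intro v hv hv'
  obtain ⟨x, hx, rfl⟩ := Finset.mem_image.1 hv
  obtain ⟨y, hy, hxy⟩ := Finset.mem_image.1 hv'
  have hx := hD x hx
  have hy := hD y hy
  refine zmod_natCast_ne_zero (N := N) (e := x + y) (by omega) (by omega) ?_
  rw [Nat.cast_add, ← hxy, neg_add_cancel]

/-- The second half of the proof of Theorem 3.2: if `a i₀ 3 + k̃ = a i₀ 0 + a i₀ 1 + a i₀ 2`
for some index `i₀` while `a j 3 + k̃ ≥ a j 0 + a j 1 + a j 2` for all `j`, then the link of
`0` in `M_{k̃+1}` has strictly more vertices than the link of `0` in `M_{k̃}`. -/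
theorem link_vertices_increase (m n : ℕ) (a : Fin m → ℕ → ℕ)
    (hpos : ∀ i, ∀ j ≤ 3, 0 < a i j)
    (hsum : ∀ i, ∑ j ∈ Finset.range 4, a i j = n)
    (kt : ℕ) (i₀ : Fin m)
    (heq : a i₀ 3 + kt = a i₀ 0 + a i₀ 1 + a i₀ 2)
    (hge : ∀ j, a j 0 + a j 1 + a j 2 ≤ a j 3 + kt) :
    {v : ZMod (n + kt) | v ≠ 0 ∧
        ∃ F ∈ ⋃ i, diffCycle (n + kt) 3 (fun j => if j = 3 then a i 3 + kt else a i j),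
          (0 : ZMod (n + kt)) ∈ F ∧ v ∈ F}.ncard <
      {v : ZMod (n + (kt + 1)) | v ≠ 0 ∧
        ∃ F ∈ ⋃ i, diffCycle (n + (kt + 1)) 3
            (fun j => if j = 3 then a i 3 + (kt + 1) else a i j),
          (0 : ZMod (n + (kt + 1))) ∈ F ∧ v ∈ F}.ncard := by
  set D : Finset ℕ := Finset.univ.biUnion fun i => posDiffs 3 (a i) with hDdef
  have hsum' : ∀ i, a i 0 + a i 1 + a i 2 + a i 3 = n := fun i => by
    rw [← hsum i]
    simp [Finset.sum_range_succ]
  have hbound : ∀ i, ∀ e ∈ posDiffs 3 (a i), 0 < e ∧ 2 * e ≤ n + kt := by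
    intro i e he
    obtain ⟨p, q, hpq, hq, rfl⟩ := mem_posDiffs.1 he
    constructor
    · exact Finset.sum_pos (fun x hx => hpos i x (by have := Finset.mem_Ico.1 hx; omega))
        (Finset.nonempty_Ico.2 hpq)
    · have hle : ∑ x ∈ Finset.Ico p q, a i x ≤ ∑ x ∈ Finset.range 3, a i x :=
        Finset.sum_le_sum_of_subset fun x hx => by
          have := Finset.mem_Ico.1 hx
          exact Finset.mem_range.2 (by omega)
      simp only [Finset.sum_range_succ, Finset.sum_range_zero, zero_add] at hle
      have := hsum' i
      have := hge i
      omega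
  have hmem : a i₀ 0 + a i₀ 1 + a i₀ 2 ∈ D := by
    refine Finset.mem_biUnion.2 ⟨i₀, Finset.mem_univ _, mem_posDiffs.2
      ⟨0, 3, by omega, le_rfl, ?_⟩⟩
    simp [Finset.sum_range_succ]
  have hcongr : ∀ k i, posDiffs 3 (fun j => if j = 3 then a i 3 + k else a i j) =
      posDiffs 3 (a i) := fun k i => posDiffs_congr fun x hx => if_neg (by omega)
  have hN : ∀ i, ∀ e ∈ posDiffs 3 (a i), 0 < e ∧ e < n + kt := fun i e he => by
    have := hbound i e he
    omega
  rw [link_vertices_eq (fun i j => if j = 3 then a i 3 + kt else a i j)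
      (fun i e he => hN i e (hcongr kt i ▸ he)),
    link_vertices_eq (fun i j => if j = 3 then a i 3 + (kt + 1) else a i j)
      (fun i e he => by have := hN i e (hcongr (kt + 1) i ▸ he); omega),
    Set.ncard_coe_finset, Set.ncard_coe_finset]
  simp only [hcongr]
  rw [← hDdef, card_image_union_image_neg (N := n + (kt + 1)) D]
  · refine card_image_union_image_neg_lt D hmem ?_
    have := hsum' i₀
    omega
  · intro e he
    obtain ⟨i, -, hi⟩ := Finset.mem_biUnion.1 he
    have := hbound i e hi
    omega
end

section
/- For every k ≥ 0, the complex L_k is 2-neighborly: for all distinct u, w ∈ ZMod (14+4k) there exists a facet F ∈ L_k with u ∈ F and w ∈ F. Equivalently, the link of the vertex 0 in L_k has exactly 13+4k vertices. -/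
/-- The 3-dimensional difference cycle `(b0 : b1 : b2 : b3)` on `n` vertices. -/
def dc4 (n b0 b1 b2 b3 : ℕ) : Set (Finset (ZMod n)) :=
  diffCycle n 3 fun j => if j = 0 then b0 else if j = 1 then b1 else if j = 2 then b2 else b3

/-- The complex `L_k` on `14 + 4k` vertices from Theorem 4.1 (the infinite series of
neighborly lens spaces). -/
def Lk (k : ℕ) : Set (Finset (ZMod (14 + 4 * k))) :=
  dc4 (14 + 4 * k) 1 1 1 (11 + 4 * k) ∪ dc4 (14 + 4 * k) 1 2 4 (7 + 4 * k) ∪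
    dc4 (14 + 4 * k) 1 4 2 (7 + 4 * k) ∪ dc4 (14 + 4 * k) 1 4 (7 + 4 * k) 2 ∪
    ⋃ i ∈ Finset.range (k + 1),
      (dc4 (14 + 4 * k) 2 (5 + 2 * i) 2 (5 + 4 * k - 2 * i) ∪
        dc4 (14 + 4 * k) 4 (2 + 2 * i) 4 (4 + 4 * k - 2 * i))

/-- The initial partial sums of `(b0 : b1 : b2 : b3)` are the elements of a member of the
difference cycle, so any two vertices differing by one of them lie in a common member. -/
theorem exists_mem_dc4_of_eq_add {n b0 b1 b2 b3 d : ℕ} {u w : ZMod n}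
    (hd : d = b0 ∨ d = b0 + b1 ∨ d = b0 + b1 + b2) (hw : w = u + d) :
    ∃ F ∈ dc4 n b0 b1 b2 b3, u ∈ F ∧ w ∈ F := by
  refine ⟨_, ⟨u, rfl⟩, ?_, ?_⟩
  · exact Finset.mem_image.2 ⟨0, Finset.mem_image.2 ⟨0, by simp, by simp⟩, by simp⟩
  · refine Finset.mem_image.2 ⟨d, ?_, hw.symm⟩
    rcases hd with rfl | rfl | rfl
    · exact Finset.mem_image.2 ⟨1, by simp, by simp⟩
    · exact Finset.mem_image.2 ⟨2, by simp, by simp [Finset.sum_range_succ]⟩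
    · exact Finset.mem_image.2 ⟨3, by simp, by simp [Finset.sum_range_succ]⟩

/-- Two vertices at cyclic distance at most half the number of vertices lie in a common facet. -/
theorem exists_facet_of_eq_add {k d : ℕ} (hd : 0 < d) (hdk : d ≤ 7 + 2 * k)
    {u w : ZMod (14 + 4 * k)} (hw : w = u + d) : ∃ F ∈ Lk k, u ∈ F ∧ w ∈ F := by
  have series (i : ℕ) (hi : i ≤ k) : dc4 (14 + 4 * k) 2 (5 + 2 * i) 2 (5 + 4 * k - 2 * i) ∪
      dc4 (14 + 4 * k) 4 (2 + 2 * i) 4 (4 + 4 * k - 2 * i) ⊆ Lk k := fun F hF =>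
    Or.inr (Set.mem_biUnion (Finset.mem_coe.2 (Finset.mem_range.2 (Nat.lt_succ_of_le hi))) hF)
  by_cases h3 : d ≤ 3
  · obtain ⟨F, hF, h⟩ := exists_mem_dc4_of_eq_add (b0 := 1) (b1 := 1) (b2 := 1)
      (b3 := 11 + 4 * k) (by omega) hw
    exact ⟨F, Or.inl (Or.inl (Or.inl (Or.inl hF))), h⟩
  by_cases h5 : d = 5
  · obtain ⟨F, hF, h⟩ := exists_mem_dc4_of_eq_add (b0 := 1) (b1 := 4) (b2 := 2)
      (b3 := 7 + 4 * k) (by omega) hw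
    exact ⟨F, Or.inl (Or.inl (Or.inr hF)), h⟩
  obtain ⟨m, hm | hm⟩ := Nat.even_or_odd' d
  · obtain ⟨F, hF, h⟩ := exists_mem_dc4_of_eq_add (b0 := 4) (b1 := 2 + 2 * (m - 3)) (b2 := 4)
      (b3 := 4 + 4 * k - 2 * (m - 3)) (by omega) hw
    exact ⟨F, series (m - 3) (by omega) (Or.inr hF), h⟩
  · obtain ⟨F, hF, h⟩ := exists_mem_dc4_of_eq_add (b0 := 2) (b1 := 5 + 2 * (m - 3)) (b2 := 2)
      (b3 := 5 + 4 * k - 2 * (m - 3)) (by omega) hw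
    exact ⟨F, series (m - 3) (by omega) (Or.inl hF), h⟩

/-- `L_k` is 2-neighborly: every two distinct vertices lie in a common facet; equivalently
the link of the vertex `0` in `L_k` has exactly `13 + 4k` vertices. -/
theorem Lk_two_neighborly (k : ℕ) :
    (∀ u w : ZMod (14 + 4 * k), u ≠ w → ∃ F ∈ Lk k, u ∈ F ∧ w ∈ F) ∧
    {v : ZMod (14 + 4 * k) | v ≠ 0 ∧ ∃ F ∈ Lk k, (0 : ZMod (14 + 4 * k)) ∈ F ∧ v ∈ F}.ncard
      = 13 + 4 * k := by
  have neighborly (u w : ZMod (14 + 4 * k)) (huw : u ≠ w) : ∃ F ∈ Lk k, u ∈ F ∧ w ∈ F := by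
    have : NeZero (14 + 4 * k) := ⟨by omega⟩
    have hlt := ZMod.val_lt (w - u)
    have hpos : 0 < (w - u).val := ZMod.val_pos.2 (sub_ne_zero.2 huw.symm)
    by_cases h : (w - u).val ≤ 7 + 2 * k
    · exact exists_facet_of_eq_add hpos h (by simp)
    · obtain ⟨F, hF, hwF, huF⟩ := exists_facet_of_eq_add (k := k) (u := w) (w := u)
        (d := 14 + 4 * k - (w - u).val) (by omega) (by omega) (by
          rw [Nat.cast_sub hlt.le, ZMod.natCast_self, ZMod.natCast_zmod_val]
          ring)
      exact ⟨F, hF, huF, hwF⟩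
  refine ⟨neighborly, ?_⟩
  have hlink : {v : ZMod (14 + 4 * k) |
      v ≠ 0 ∧ ∃ F ∈ Lk k, (0 : ZMod (14 + 4 * k)) ∈ F ∧ v ∈ F} = {0}ᶜ := by
    ext v
    exact ⟨fun h => h.1, fun h => ⟨h, neighborly 0 v (Ne.symm h)⟩⟩
  have : NeZero (14 + 4 * k) := ⟨by omega⟩
  rw [hlink, Set.ncard_compl, Set.ncard_singleton, Nat.card_zmod]
  omega
end

section
/- Fix k ≥ 0 and set n = 14+4k. A facet F ∈ L_k has all four of its vertices of the same parity (all even or all odd) if and only if F belongs to the union ⋃_{i=0}^{k} (4 : 2+2i : 4 : 4+4k−2i) of difference cycles. -/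
theorem ZMod.val_mod_two_eq_iff {n : ℕ} [NeZero n] (hn : 2 ∣ n) (v : ZMod n) (r : ℕ) :
    v.val % 2 = r % 2 ↔ ZMod.castHom hn (ZMod 2) v = (r : ZMod 2) := by
  rw [← ZMod.natCast_eq_natCast_iff', ← map_natCast (ZMod.castHom hn (ZMod 2)) v.val,
    ZMod.natCast_zmod_val]

/-- On an even number of vertices, the members of `(b0 : b1 : b2 : b3)` have vertices of a single
parity exactly when the first three differences are even. -/
theorem same_parity_iff_of_mem_dc4 {n b0 b1 b2 b3 : ℕ} [NeZero n] (hn : 2 ∣ n)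
    {F : Finset (ZMod n)} (hF : F ∈ dc4 n b0 b1 b2 b3) :
    ((∀ v ∈ F, v.val % 2 = 0) ∨ (∀ v ∈ F, v.val % 2 = 1)) ↔
      Even b0 ∧ Even b1 ∧ Even b2 := by
  obtain ⟨t, rfl⟩ := hF
  have h0 (v : ZMod n) := ZMod.val_mod_two_eq_iff hn v 0
  have h1 (v : ZMod n) := ZMod.val_mod_two_eq_iff hn v 1
  simp only [Nat.zero_mod, Nat.one_mod, Nat.cast_zero, Nat.cast_one] at h0 h1
  simp only [h0, h1, ← ZMod.natCast_eq_zero_iff_even, repSet, Finset.forall_mem_image,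
    Finset.range_add_one, Finset.range_zero, Finset.forall_mem_insert, Finset.notMem_empty,
    IsEmpty.forall_iff, implies_true, and_true, map_add, map_natCast]
  simp
  generalize (ZMod.cast t : ZMod 2) = τ, (b0 : ZMod 2) = x, (b1 : ZMod 2) = y, (b2 : ZMod 2) = z
  revert τ x y z
  decide

/-- A facet of `L_k` has all four of its vertices of the same parity if and only if it
belongs to the union of the difference cycles `(4 : 2+2i : 4 : 4+4k-2i)`, `0 ≤ i ≤ k`. -/
theorem Lk_same_parity_facets (k : ℕ) (F : Finset (ZMod (14 + 4 * k))) (hF : F ∈ Lk k) :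
    ((∀ v ∈ F, v.val % 2 = 0) ∨ (∀ v ∈ F, v.val % 2 = 1)) ↔
      F ∈ ⋃ i ∈ Finset.range (k + 1),
        dc4 (14 + 4 * k) 4 (2 + 2 * i) 4 (4 + 4 * k - 2 * i) := by
  have hn : 2 ∣ 14 + 4 * k := by omega
  have : NeZero (14 + 4 * k) := ⟨by omega⟩
  simp only [Set.mem_iUnion, exists_prop]
  constructor
  · intro h
    simp only [Lk, Set.mem_union, Set.mem_iUnion, exists_prop] at hF
    rcases hF with (((hF | hF) | hF) | hF) | ⟨i, hi, hF | hF⟩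
    on_goal 6 => exact ⟨i, hi, hF⟩
    all_goals
      have := (same_parity_iff_of_mem_dc4 hn hF).1 h
      simp only [Nat.even_iff] at this
      omega
  · rintro ⟨i, -, hF⟩
    exact (same_parity_iff_of_mem_dc4 hn hF).2 ⟨by decide, ⟨1 + i, by ring⟩, by decide⟩
end

section
/- Fix k ≥ 0 and set n = 14+4k. The number of facets F ∈ L_k containing exactly two even vertices (and hence exactly two odd vertices) is 4k² + 24k + 35, and the number of facets F ∈ L_k containing exactly one or exactly three even vertices is 8k + 28. (These are the numbers of quadrilaterals and of triangles of the slicing of L_k between the even and the odd vertices.) -/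
/-- The translate by `t` of the set `{0, a, b, c}`, taken modulo `n`. -/
def facet (n a b c t : ℕ) : Finset (ZMod n) :=
  Finset.image (fun x : ℕ => (x : ZMod n)) {t, t + a, t + b, t + c}

lemma mem_dc4_iff {n b0 b1 b2 b3 : ℕ} (hn : 0 < n) {F : Finset (ZMod n)} :
    F ∈ dc4 n b0 b1 b2 b3 ↔ ∃ t < n, F = facet n b0 (b0 + b1) (b0 + b1 + b2) t := by
  have : NeZero n := ⟨hn.ne'⟩
  have key : ∀ t : ℕ, ((repSet n 3 fun j => if j = 0 then b0 else if j = 1 then b1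
      else if j = 2 then b2 else b3).image fun x => (t : ZMod n) + x)
        = facet n b0 (b0 + b1) (b0 + b1 + b2) t := by
    intro t
    simp [repSet, facet, Finset.range_add_one, Finset.sum_insert, Finset.image_insert]
    ext x
    simp only [Finset.mem_insert, Finset.mem_singleton]
    have h1 : (b1 : ZMod n) + b0 = b0 + b1 := add_comm _ _
    have h2 : (b2 : ZMod n) + (b0 + b1) = b0 + b1 + b2 := add_comm _ _
    simp only [h1, h2]
    tauto
  constructor
  · rintro ⟨t, rfl⟩
    refine ⟨t.val, t.val_lt, ?_⟩
    rw [← key, ZMod.natCast_zmod_val]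
  · rintro ⟨t, -, rfl⟩
    exact ⟨t, (key t).symm⟩

lemma card_filter_even_facet {n a b c t : ℕ} (hn : n % 2 = 0) (ha : 0 < a) (hab : a < b)
    (hbc : b < c) (hc : c < n) :
    ((facet n a b c t).filter fun v => v.val % 2 = 0).card
      = (if t % 2 = 0 then 1 else 0) + (if (t + a) % 2 = 0 then 1 else 0)
        + (if (t + b) % 2 = 0 then 1 else 0) + (if (t + c) % 2 = 0 then 1 else 0) := by
  have hval (x : ℕ) : (x : ZMod n).val % 2 = x % 2 := by
    rw [ZMod.val_natCast, Nat.mod_mod_of_dvd _ (Nat.dvd_of_mod_eq_zero hn)]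
  have hinj : Set.InjOn (fun x : ℕ => (x : ZMod n)) (Set.Ico t (t + n)) := by
    intro x hx y hy hxy
    exact Nat.mod_injOn_Ico t n (by simpa using hx) (by simpa using hy)
      ((ZMod.natCast_eq_natCast_iff' x y n).1 hxy)
  rw [facet, Finset.filter_image, Finset.card_image_of_injOn, Finset.card_filter]
  · simp only [hval]
    rw [Finset.sum_insert, Finset.sum_insert, Finset.sum_insert, Finset.sum_singleton]
    · ring
    all_goals
      simp only [Finset.mem_insert, Finset.mem_singleton]
      omega
  · refine hinj.mono fun x hx => ?_
    simp only [Finset.coe_filter, Finset.mem_insert, Finset.mem_singleton,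
      Set.mem_ofPred_eq] at hx
    simp only [Set.mem_Ico]
    omega

/-- Equal facets differ by a translation `d` mapping one representative into the other. -/
lemma facet_eq_facet {n a b c a' b' c' t s : ℕ} (ht : t < n) (hs : s < n)
    (ha : a < n) (hb : b < n) (hc : c < n) (ha' : a' < n) (hb' : b' < n) (hc' : c' < n)
    (h : facet n a b c t = facet n a' b' c' s) :
    ∃ d < n, (t = s + d ∨ t + n = s + d) ∧ (d = 0 ∨ d = a' ∨ d = b' ∨ d = c') ∧
      ∀ e, e = a ∨ e = b ∨ e = c →
        (d + e = 0 ∨ d + e = a' ∨ d + e = b' ∨ d + e = c') ∨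
        (d + e = n ∨ d + e = n + a' ∨ d + e = n + b' ∨ d + e = n + c') := by
  obtain ⟨d, hd, htd⟩ : ∃ d < n, t = s + d ∨ t + n = s + d := by
    by_cases hst : s ≤ t
    · exact ⟨t - s, by omega, by omega⟩
    · exact ⟨t + n - s, by omega, by omega⟩
  have hmod (x y : ℕ) (hx : x < n) (hy : y < n) (hxy : ((t + x : ℕ) : ZMod n) = (s + y : ℕ)) :
      d + x = y ∨ d + x = n + y := by
    have h1 : s + (d + x) ≡ s + y [MOD n] := by
      rw [← add_assoc]
      refine Nat.ModEq.trans ?_ ((ZMod.natCast_eq_natCast_iff _ _ _).1 hxy)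
      rcases htd with htd | htd
      · rw [htd]
      · rw [← htd, add_right_comm]
        exact Nat.add_modEq_right
    have h2 := Nat.ModEq.add_left_cancel' s h1
    have h3 : (d + x) % n = y := by rw [h2, Nat.mod_eq_of_lt hy]
    rcases lt_or_ge (d + x) n with h4 | h4
    · rw [Nat.mod_eq_of_lt h4] at h3
      exact .inl h3
    · rw [Nat.mod_eq_sub_mod h4, Nat.mod_eq_of_lt (by omega)] at h3
      omega
  have hmem (x : ℕ) (hx : x < n) (hxm : x = 0 ∨ x = a ∨ x = b ∨ x = c) :
      ∃ y, (y = 0 ∨ y = a' ∨ y = b' ∨ y = c') ∧ (d + x = y ∨ d + x = n + y) := by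
    have h1 : ((t + x : ℕ) : ZMod n) ∈ facet n a' b' c' s := by
      rw [← h]
      refine Finset.mem_image_of_mem _ ?_
      simp only [Finset.mem_insert, Finset.mem_singleton]
      omega
    obtain ⟨z, hz, hzx⟩ := Finset.mem_image.1 h1
    simp only [Finset.mem_insert, Finset.mem_singleton] at hz
    obtain ⟨y, rfl, hy⟩ : ∃ y, z = s + y ∧ (y = 0 ∨ y = a' ∨ y = b' ∨ y = c') :=
      ⟨z - s, by omega, by omega⟩
    exact ⟨y, hy, hmod x y hx (by omega) hzx.symm⟩
  refine ⟨d, hd, htd, ?_, fun e he => ?_⟩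
  · obtain ⟨y, hy, hdy⟩ := hmem 0 (by omega) (.inl rfl)
    omega
  · obtain ⟨y, hy, hdy⟩ := hmem e (by omega) (by omega)
    omega

/-- The facets with two even and two odd vertices, indexed by cycle and translation. -/
def quad (k : ℕ) : ℕ × ℕ → Finset (ZMod (14 + 4 * k))
  | (0, t) => facet _ 1 2 3 t
  | (1, t) => facet _ 1 5 (12 + 4 * k) t
  | (i + 2, t) => facet _ 2 (7 + 2 * i) (9 + 2 * i) t

/-- The indices of `quad`; the last cycle has only half the length. -/
def quadIndex (k : ℕ) : Finset (ℕ × ℕ) :=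
  Finset.range (k + 2) ×ˢ Finset.range (14 + 4 * k) ∪ {k + 2} ×ˢ Finset.range (7 + 2 * k)

/-- The facets with an odd number of even vertices, indexed by cycle and translation. -/
def tri (k : ℕ) : ℕ × ℕ → Finset (ZMod (14 + 4 * k))
  | (0, t) => facet _ 1 3 7 t
  | (_, t) => facet _ 1 5 7 t

lemma mem_quadIndex {k i t : ℕ} :
    (i, t) ∈ quadIndex k ↔ (i < k + 2 ∧ t < 14 + 4 * k) ∨ (i = k + 2 ∧ t < 7 + 2 * k) := by
  simp [quadIndex]
  omega

lemma card_quadIndex (k : ℕ) : (quadIndex k).card = 4 * k ^ 2 + 24 * k + 35 := by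
  rw [quadIndex, Finset.card_union_of_disjoint]
  · simp only [Finset.card_product, Finset.card_range, Finset.card_singleton]
    ring
  · rw [Finset.disjoint_left]
    rintro ⟨i, t⟩ h1 h2
    simp only [Finset.mem_product, Finset.mem_range, Finset.mem_singleton] at h1 h2
    omega

lemma quad_injOn (k : ℕ) : Set.InjOn (quad k) (quadIndex k) := by
  rintro ⟨i, t⟩ hi ⟨j, s⟩ hj h
  rw [Finset.mem_coe, mem_quadIndex] at hi hj
  rw [Prod.mk.injEq]
  rcases i with _ | _ | i <;> rcases j with _ | _ | j <;>
  · simp only [quad] at h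
    obtain ⟨d, hd, hts, h0, he⟩ := facet_eq_facet (by omega) (by omega) (by omega) (by omega)
      (by omega) (by omega) (by omega) (by omega) h
    have h1 := he _ (.inl rfl)
    have h2 := he _ (.inr (.inl rfl))
    have h3 := he _ (.inr (.inr rfl))
    clear he h
    rcases h0 with rfl | rfl | rfl | rfl <;> omega

lemma tri_injOn (k : ℕ) :
    Set.InjOn (tri k) (Finset.range 2 ×ˢ Finset.range (14 + 4 * k) : Finset (ℕ × ℕ)) := by
  rintro ⟨i, t⟩ hi ⟨j, s⟩ hj h
  rw [Finset.mem_coe, Finset.mem_product, Finset.mem_range, Finset.mem_range] at hi hj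
  rw [Prod.mk.injEq]
  rcases i with _ | i <;> rcases j with _ | j <;>
  · simp only [tri] at h
    obtain ⟨d, hd, hts, h0, he⟩ := facet_eq_facet (by omega) (by omega) (by omega) (by omega)
      (by omega) (by omega) (by omega) (by omega) h
    have h1 := he _ (.inl rfl)
    have h2 := he _ (.inr (.inl rfl))
    have h3 := he _ (.inr (.inr rfl))
    clear he h
    rcases h0 with rfl | rfl | rfl | rfl <;> omega

lemma facet_add_half (k t : ℕ) :
    facet (14 + 4 * k) 2 (7 + 2 * k) (9 + 2 * k) (t + (7 + 2 * k))
      = facet (14 + 4 * k) 2 (7 + 2 * k) (9 + 2 * k) t := by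
  have h : (14 + 4 * k : ZMod (14 + 4 * k)) = 0 := by
    exact_mod_cast ZMod.natCast_self (14 + 4 * k)
  have h1 : (t + (7 + 2 * k) + (7 + 2 * k) : ZMod (14 + 4 * k)) = t := by
    linear_combination h
  have h2 : (t + (7 + 2 * k) + (9 + 2 * k) : ZMod (14 + 4 * k)) = t + 2 := by
    linear_combination h
  have h3 : (t + (7 + 2 * k) + 2 : ZMod (14 + 4 * k)) = t + (9 + 2 * k) := by ring
  ext x
  simp only [facet, Finset.image_insert, Finset.image_singleton, Nat.cast_add, Nat.cast_mul,
    Nat.cast_ofNat, h1, h2, h3, Finset.mem_insert, Finset.mem_singleton]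
  tauto

lemma mem_Lk_iff {k : ℕ} {F : Finset (ZMod (14 + 4 * k))} :
    F ∈ Lk k ↔ ∃ t < 14 + 4 * k,
      F = facet _ 1 2 3 t ∨ F = facet _ 1 3 7 t ∨ F = facet _ 1 5 7 t ∨
      F = facet _ 1 5 (12 + 4 * k) t ∨
      ∃ i ≤ k, F = facet _ 2 (7 + 2 * i) (9 + 2 * i) t ∨
        F = facet _ 4 (6 + 2 * i) (10 + 2 * i) t := by
  have e1 (i : ℕ) : 2 + (5 + 2 * i) = 7 + 2 * i := by ring
  have e2 (i : ℕ) : 7 + 2 * i + 2 = 9 + 2 * i := by ring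
  have e3 (i : ℕ) : 4 + (2 + 2 * i) = 6 + 2 * i := by ring
  have e4 (i : ℕ) : 6 + 2 * i + 4 = 10 + 2 * i := by ring
  have e5 : 5 + (7 + 4 * k) = 12 + 4 * k := by ring
  simp only [Lk, Set.mem_union, Set.mem_iUnion, Finset.mem_range, Nat.lt_succ_iff,
    mem_dc4_iff (show 0 < 14 + 4 * k by omega), exists_prop, Nat.reduceAdd, e1, e2, e3, e4, e5]
  constructor
  · rintro ((((⟨t, ht, h⟩ | ⟨t, ht, h⟩) | ⟨t, ht, h⟩) | ⟨t, ht, h⟩) |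
      ⟨i, hi, ⟨t, ht, h⟩ | ⟨t, ht, h⟩⟩) <;> refine ⟨t, ht, ?_⟩ <;> grind
  · rintro ⟨t, ht, h | h | h | h | ⟨i, hi, h⟩⟩
    · exact .inl (.inl (.inl (.inl ⟨t, ht, h⟩)))
    · exact .inl (.inl (.inl (.inr ⟨t, ht, h⟩)))
    · exact .inl (.inl (.inr ⟨t, ht, h⟩))
    · exact .inl (.inr ⟨t, ht, h⟩)
    · exact .inr ⟨i, hi, h.imp (fun h => ⟨t, ht, h⟩) fun h => ⟨t, ht, h⟩⟩

lemma quad_facets_eq (k : ℕ) :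
    {F ∈ Lk k | (F.filter fun v => v.val % 2 = 0).card = 2} = quad k '' quadIndex k := by
  ext F
  rw [Set.mem_ofPred_eq, mem_Lk_iff, Set.mem_image]
  constructor
  · rintro ⟨⟨t, ht, rfl | rfl | rfl | rfl | ⟨i, hi, rfl | rfl⟩⟩, hF⟩
    · exact ⟨(0, t), mem_quadIndex.2 (by omega), rfl⟩
    · rw [card_filter_even_facet] at hF <;> first | omega | (split_ifs at hF <;> omega)
    · rw [card_filter_even_facet] at hF <;> first | omega | (split_ifs at hF <;> omega)
    · exact ⟨(1, t), mem_quadIndex.2 (by omega), rfl⟩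
    · by_cases h : i = k ∧ 7 + 2 * k ≤ t
      · obtain ⟨rfl, h⟩ := h
        refine ⟨(i + 2, t - (7 + 2 * i)), mem_quadIndex.2 (by omega), ?_⟩
        rw [quad, ← facet_add_half, Nat.sub_add_cancel h]
      · exact ⟨(i + 2, t), mem_quadIndex.2 (by omega), rfl⟩
    · rw [card_filter_even_facet] at hF <;> first | omega | (split_ifs at hF <;> omega)
  · rintro ⟨⟨i, t⟩, hi, rfl⟩
    rw [Finset.mem_coe, mem_quadIndex] at hi
    refine ⟨⟨t, by omega, ?_⟩, ?_⟩
    · rcases i with _ | _ | i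
      · exact .inl rfl
      · exact .inr (.inr (.inr (.inl rfl)))
      · exact .inr (.inr (.inr (.inr ⟨i, by omega, .inl rfl⟩)))
    · rcases i with _ | _ | i <;>
      · simp only [quad]
        rw [card_filter_even_facet] <;> first | omega | (split_ifs <;> omega)

lemma tri_facets_eq (k : ℕ) :
    {F ∈ Lk k | (F.filter fun v => v.val % 2 = 0).card = 1 ∨
        (F.filter fun v => v.val % 2 = 0).card = 3}
      = tri k '' (Finset.range 2 ×ˢ Finset.range (14 + 4 * k) : Finset (ℕ × ℕ)) := by
  ext F
  rw [Set.mem_ofPred_eq, mem_Lk_iff, Set.mem_image]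
  constructor
  · rintro ⟨⟨t, ht, rfl | rfl | rfl | rfl | ⟨i, hi, rfl | rfl⟩⟩, hF⟩
    case inr.inl => exact ⟨(0, t), by simpa using ht, rfl⟩
    case inr.inr.inl => exact ⟨(1, t), by simpa using ht, rfl⟩
    all_goals
      rw [card_filter_even_facet] at hF <;> first | omega | (split_ifs at hF <;> omega)
  · rintro ⟨⟨i, t⟩, hi, rfl⟩
    rw [Finset.mem_coe, Finset.mem_product, Finset.mem_range, Finset.mem_range] at hi
    refine ⟨⟨t, hi.2, ?_⟩, ?_⟩
    · rcases i with _ | i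
      · exact .inr (.inl rfl)
      · exact .inr (.inr (.inl rfl))
    · rcases i with _ | i <;>
      · simp only [tri]
        rw [card_filter_even_facet] <;> first | omega | (split_ifs <;> omega)

/-- The number of facets of `L_k` with exactly two even vertices is `4k² + 24k + 35`
(the quadrilaterals of the slicing), and the number of facets with exactly one or exactly
three even vertices is `8k + 28` (the triangles of the slicing). -/
theorem Lk_slicing_facet_counts (k : ℕ) :
    {F ∈ Lk k | (F.filter fun v => v.val % 2 = 0).card = 2}.ncard
        = 4 * k ^ 2 + 24 * k + 35 ∧
    {F ∈ Lk k | (F.filter fun v => v.val % 2 = 0).card = 1 ∨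
        (F.filter fun v => v.val % 2 = 0).card = 3}.ncard = 8 * k + 28 := by
  rw [quad_facets_eq, tri_facets_eq, (quad_injOn k).ncard_image, (tri_injOn k).ncard_image,
    Set.ncard_coe_finset, Set.ncard_coe_finset, card_quadIndex, Finset.card_product,
    Finset.card_range, Finset.card_range]
  exact ⟨rfl, by ring⟩
end

section
/- Fix k ≥ 0 and set n = 14+4k. The number of 2-element subsets {u, w} of ZMod n with u even and w odd that are contained in some facet of L_k is 4k² + 28k + 49, and the number of 3-element subsets of ZMod n containing both an even and an odd element that are contained in some facet of L_k is 8k² + 60k + 112. (These are the numbers of vertices and of edges of the slicing of L_k between the even and the odd vertices.) -/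
/-- A facet of the difference cycle `(b0 : b1 : b2 : b3)` is a translate of its representative. -/
lemma mem_dc4 {n b0 b1 b2 b3 : ℕ} {F : Finset (ZMod n)} :
    F ∈ dc4 n b0 b1 b2 b3 ↔ ∃ t : ZMod n,
      F = {t, t + (b0 : ℕ), t + (b0 + b1 : ℕ), t + (b0 + b1 + b2 : ℕ)} := by
  unfold dc4 diffCycle repSet
  simp [Finset.range_add_one, Finset.image_insert, Finset.ext_iff]
  refine exists_congr fun t => forall_congr' fun x => ?_
  grind

lemma even_fourteen_add (k : ℕ) : 2 ∣ 14 + 4 * k := by omega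

/-- The parity of a residue modulo `14 + 4k`. -/
def parity (k : ℕ) : ZMod (14 + 4 * k) →+* ZMod 2 :=
  ZMod.castHom (even_fourteen_add k) (ZMod 2)

lemma parity_apply (k : ℕ) (u : ZMod (14 + 4 * k)) : parity k u = (u.val : ZMod 2) := by
  have : NeZero (14 + 4 * k) := ⟨by omega⟩
  simp [parity]

lemma parity_eq_zero {k : ℕ} {u : ZMod (14 + 4 * k)} : parity k u = 0 ↔ u.val % 2 = 0 := by
  rw [parity_apply, ZMod.natCast_eq_zero_iff]
  omega

lemma parity_eq_one {k : ℕ} {u : ZMod (14 + 4 * k)} : parity k u = 1 ↔ u.val % 2 = 1 := by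
  rw [parity_apply, ZMod.natCast_eq_one_iff_odd, Nat.odd_iff]

lemma parity_natCast_of_odd {k a : ℕ} (ha : a % 2 = 1) : parity k (a : ZMod (14 + 4 * k)) = 1 := by
  rw [map_natCast, ZMod.natCast_eq_one_iff_odd, Nat.odd_iff, ha]

lemma parity_natCast_of_even {k a : ℕ} (ha : a % 2 = 0) :
    parity k (a : ZMod (14 + 4 * k)) = 0 := by
  rw [map_natCast, ZMod.natCast_eq_zero_iff, Nat.dvd_iff_mod_eq_zero, ha]

lemma parity_ofNat_of_odd {k a : ℕ} [a.AtLeastTwo] (ha : a % 2 = 1) :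
    parity k (OfNat.ofNat a) = 1 :=
  (congrArg (parity k) (Nat.cast_ofNat (n := a)).symm).trans (parity_natCast_of_odd ha)

lemma parity_ofNat_of_even {k a : ℕ} [a.AtLeastTwo] (ha : a % 2 = 0) :
    parity k (OfNat.ofNat a) = 0 :=
  (congrArg (parity k) (Nat.cast_ofNat (n := a)).symm).trans (parity_natCast_of_even ha)

/-- The pairs `(a, b)` of odd differences, `a < b`, for which `{v, v + a, v + b}` is a
face of `L_k`. -/
def oddPairs (k : ℕ) : Finset (ℕ × ℕ) :=
  {(1, 3), (1, 5), (1, 7), (3, 7), (1, 13 + 4 * k), (11 + 4 * k, 13 + 4 * k)} ∪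
    (Finset.range (2 * k + 2)).image fun j => (5 + 2 * j, 7 + 2 * j)

lemma mem_oddPairs {k a b : ℕ} : (a, b) ∈ oddPairs k ↔
    (a = 1 ∧ b = 3) ∨ (a = 1 ∧ b = 5) ∨ (a = 1 ∧ b = 7) ∨ (a = 3 ∧ b = 7) ∨
      (a = 1 ∧ b = 13 + 4 * k) ∨ (a = 11 + 4 * k ∧ b = 13 + 4 * k) ∨
      ∃ j < 2 * k + 2, 5 + 2 * j = a ∧ 7 + 2 * j = b := by
  simp only [oddPairs, Finset.mem_union, Finset.mem_insert, Finset.mem_singleton, Prod.mk.injEq,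
    Finset.mem_image, Finset.mem_range, or_assoc]

lemma card_oddPairs (k : ℕ) : (oddPairs k).card = 2 * k + 8 := by
  unfold oddPairs
  rw [Finset.card_union_of_disjoint, Finset.card_image_of_injective, Finset.card_range]
  · repeat rw [Finset.card_insert_of_notMem (by simp; omega)]
    simp
    omega
  · intro i j h
    simpa using h
  · rw [Finset.disjoint_left]
    rintro ⟨a, b⟩ h h'
    simp only [Finset.mem_insert, Finset.mem_singleton, Prod.mk.injEq, Finset.mem_image,
      Finset.mem_range] at h h'
    obtain ⟨j, hj, rfl, rfl⟩ := h'
    omega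

lemma oddPairs_spec {k a b : ℕ} (h : (a, b) ∈ oddPairs k) :
    a % 2 = 1 ∧ b % 2 = 1 ∧ a < b ∧ b < 14 + 4 * k := by
  rcases mem_oddPairs.1 h with h | h | h | h | h | h | ⟨j, hj, rfl, rfl⟩ <;> omega

lemma exists_oddPairs {k d : ℕ} (hd : d % 2 = 1) (hn : d < 14 + 4 * k) :
    ∃ a b, (a, b) ∈ oddPairs k ∧ (d = a ∨ d = b) := by
  obtain h | h | h | h | h | h : d = 1 ∨ d = 3 ∨ d = 9 + 4 * k ∨ d = 11 + 4 * k ∨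
    d = 13 + 4 * k ∨ (5 ≤ d ∧ d < 9 + 4 * k) := by omega
  · exact ⟨1, 3, mem_oddPairs.2 (by omega), by omega⟩
  · exact ⟨1, 3, mem_oddPairs.2 (by omega), by omega⟩
  · refine ⟨7 + 4 * k, 9 + 4 * k, mem_oddPairs.2 ?_, by omega⟩
    iterate 6 right
    exact ⟨2 * k + 1, by omega, by omega, by omega⟩
  · exact ⟨11 + 4 * k, 13 + 4 * k, mem_oddPairs.2 (by omega), by omega⟩
  · exact ⟨11 + 4 * k, 13 + 4 * k, mem_oddPairs.2 (by omega), by omega⟩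
  · refine ⟨d, d + 2, mem_oddPairs.2 ?_, by omega⟩
    iterate 6 right
    exact ⟨(d - 5) / 2, by omega, by omega, by omega⟩

/-- The triangle `{v, v + a, v + b}`. -/
def apexTriangle (k : ℕ) (q : ZMod (14 + 4 * k) × ℕ × ℕ) : Finset (ZMod (14 + 4 * k)) :=
  {q.1, q.1 + (q.2.1 : ℕ), q.1 + (q.2.2 : ℕ)}

lemma fourteen_add_eq_zero (k : ℕ) : (14 + 4 * k : ZMod (14 + 4 * k)) = 0 := by
  exact_mod_cast ZMod.natCast_self (14 + 4 * k)

lemma natCast_inj_of_lt {n a b : ℕ} (ha : a < n) (hb : b < n)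
    (h : (a : ZMod n) = (b : ZMod n)) : a = b := by
  rwa [ZMod.natCast_eq_natCast_iff', Nat.mod_eq_of_lt ha, Nat.mod_eq_of_lt hb] at h

lemma mem_Lk {k : ℕ} {F : Finset (ZMod (14 + 4 * k))} : F ∈ Lk k ↔ ∃ t : ZMod (14 + 4 * k),
    F = {t, t + 1, t + 2, t + 3} ∨ F = {t, t + 1, t + 3, t + 7} ∨ F = {t, t + 1, t + 5, t + 7} ∨
    F = {t, t + 1, t + 5, t - 2} ∨ ∃ i : ℕ, i ≤ k ∧ (F = {t, t + 2, t + 7 + 2 * i, t + 9 + 2 * i} ∨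
      F = {t, t + 4, t + 6 + 2 * i, t + 10 + 2 * i}) := by
  have h1 (t : ZMod (14 + 4 * k)) : t + (1 + 4 + (7 + 4 * k) : ℕ) = t - 2 := by
    push_cast
    linear_combination fourteen_add_eq_zero k
  have h2 (t : ZMod (14 + 4 * k)) (i : ℕ) : t + (2 + (5 + 2 * i) : ℕ) = t + 7 + 2 * i := by
    push_cast
    ring
  have h3 (t : ZMod (14 + 4 * k)) (i : ℕ) : t + (2 + (5 + 2 * i) + 2 : ℕ) = t + 9 + 2 * i := by
    push_cast
    ring
  have h4 (t : ZMod (14 + 4 * k)) (i : ℕ) : t + (4 + (2 + 2 * i) : ℕ) = t + 6 + 2 * i := by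
    push_cast
    ring
  have h5 (t : ZMod (14 + 4 * k)) (i : ℕ) : t + (4 + (2 + 2 * i) + 4 : ℕ) = t + 10 + 2 * i := by
    push_cast
    ring
  simp only [Lk, Set.mem_union, Set.mem_iUnion, mem_dc4, h1, h2, h3, h4, h5, Finset.mem_range,
    Nat.lt_succ_iff, exists_prop]
  norm_num
  simp only [exists_or, or_assoc]
  rw [exists_comm (α := ZMod (14 + 4 * k)) (β := ℕ)]
  simp only [exists_and_left, exists_or]

lemma apexTriangle_subset_facet {k a b : ℕ} (v : ZMod (14 + 4 * k)) (h : (a, b) ∈ oddPairs k) :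
    ∃ F ∈ Lk k, apexTriangle k (v, a, b) ⊆ F := by
  have hk := fourteen_add_eq_zero k
  have key (x y z w : ZMod (14 + 4 * k)) (hF : {x, y, z, w} ∈ Lk k)
      (h0 : v = x ∨ v = y ∨ v = z ∨ v = w)
      (ha : v + a = x ∨ v + a = y ∨ v + a = z ∨ v + a = w)
      (hb : v + b = x ∨ v + b = y ∨ v + b = z ∨ v + b = w) :
      ∃ F ∈ Lk k, apexTriangle k (v, a, b) ⊆ F := by
    refine ⟨_, hF, ?_⟩
    simp only [apexTriangle, Finset.insert_subset_iff, Finset.singleton_subset_iff,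
      Finset.mem_insert, Finset.mem_singleton]
    exact ⟨h0, ha, hb⟩
  rcases mem_oddPairs.1 h with ⟨rfl, rfl⟩ | ⟨rfl, rfl⟩ | ⟨rfl, rfl⟩ | ⟨rfl, rfl⟩ | ⟨rfl, rfl⟩ |
    ⟨rfl, rfl⟩ | ⟨j, hj, rfl, rfl⟩
  · exact key v (v + 1) (v + 2) (v + 3) (mem_Lk.2 ⟨v, by simp⟩) (by simp) (by simp) (by simp)
  · exact key v (v + 1) (v + 5) (v + 7) (mem_Lk.2 ⟨v, by simp⟩) (by simp) (by simp) (by simp)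
  · exact key v (v + 1) (v + 5) (v + 7) (mem_Lk.2 ⟨v, by simp⟩) (by simp) (by simp) (by simp)
  · exact key v (v + 1) (v + 3) (v + 7) (mem_Lk.2 ⟨v, by simp⟩) (by simp) (by simp) (by simp)
  · refine key (v - 1) (v - 1 + 1) (v - 1 + 2) (v - 1 + 3) (mem_Lk.2 ⟨v - 1, by simp⟩) ?_ ?_ ?_
    · grind
    · grind
    · left
      push_cast
      linear_combination hk
  · refine key (v - 3) (v - 3 + 1) (v - 3 + 2) (v - 3 + 3) (mem_Lk.2 ⟨v - 3, by simp⟩) ?_ ?_ ?_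
    · grind
    · left
      push_cast
      linear_combination hk
    · right; right; left
      push_cast
      linear_combination hk
  · obtain hj' | hj' := le_or_gt j k
    · refine key (v - 2) (v - 2 + 2) (v - 2 + 7 + 2 * j) (v - 2 + 9 + 2 * j)
        (mem_Lk.2 ⟨v - 2, ?_⟩) ?_ ?_ ?_
      · iterate 4 right
        exact ⟨j, hj', Or.inl rfl⟩
      all_goals push_cast; grind
    · obtain ⟨i, hi⟩ : ∃ i, j + i = 2 * k + 1 := ⟨2 * k + 1 - j, by omega⟩
      have hi' : (j + i : ZMod (14 + 4 * k)) = 2 * k + 1 := by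
        exact_mod_cast congrArg (Nat.cast (R := ZMod (14 + 4 * k))) hi
      let t : ZMod (14 + 4 * k) := v - 7 - 2 * i
      refine key t (t + 2) (t + 7 + 2 * i) (t + 9 + 2 * i) (mem_Lk.2 ⟨t, ?_⟩) ?_ ?_ ?_
      · iterate 4 right
        exact ⟨i, by omega, Or.inl rfl⟩
      · right; right; left
        ring
      · left
        push_cast
        linear_combination hk + 2 * hi'
      · right; left
        push_cast
        linear_combination hk + 2 * hi'

lemma eq_triple_of_subset {α : Type*} [DecidableEq α] {a b c d : α} {e : Finset α}
    (he : e.card = 3) (h : e ⊆ {a, b, c, d}) :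
    e = {a, b, c} ∨ e = {a, b, d} ∨ e = {a, c, d} ∨ e = {b, c, d} := by
  have key {x y z w : α} (hw : e ⊆ {w, x, y, z}) (hne : e ≠ {x, y, z}) :
      w ∈ e ∧ w ∉ ({x, y, z} : Finset α) := by
    have hsub : ¬ e ⊆ {x, y, z} := fun hs =>
      hne (Finset.eq_of_subset_of_card_le hs (he ▸ Finset.card_le_three))
    obtain ⟨u, hu, hu'⟩ := Finset.not_subset.1 hsub
    obtain rfl | hu'' := Finset.mem_insert.1 (hw hu)
    · exact ⟨hu, hu'⟩
    · exact absurd hu'' hu'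
  by_contra! hne
  obtain ⟨hd, hd'⟩ := key (w := d) (h.trans (by grind)) hne.1
  obtain ⟨hc, hc'⟩ := key (w := c) (h.trans (by grind)) hne.2.1
  obtain ⟨hb, hb'⟩ := key (w := b) (h.trans (by grind)) hne.2.2.1
  obtain ⟨ha, ha'⟩ := key h hne.2.2.2
  have hsub : {a, b, c, d} ⊆ e := by
    simp [Finset.insert_subset_iff, ha, hb, hc, hd]
  have hcard := Finset.card_le_card hsub
  rw [Finset.card_insert_of_notMem ha', Finset.card_eq_three.2 ⟨b, c, d, by grind⟩] at hcard
  omega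

set_option maxHeartbeats 1000000 in
/-- Every triangle of `L_k` with vertices of both parities has the form `{v, v + a, v + b}` for
some pair `(a, b)` of odd differences. -/
lemma exists_apexTriangle {k : ℕ} {e F : Finset (ZMod (14 + 4 * k))} (he : e.card = 3)
    (h0 : ∃ u ∈ e, parity k u = 0) (h1 : ∃ w ∈ e, parity k w = 1) (hF : F ∈ Lk k) (heF : e ⊆ F) :
    ∃ v a b, (a, b) ∈ oddPairs k ∧ apexTriangle k (v, a, b) = e := by
  have hk := fourteen_add_eq_zero k
  have key (x y z : ZMod (14 + 4 * k)) (a b : ℕ) (hab : (a, b) ∈ oddPairs k) (hy : x + a = y)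
      (hz : x + b = z) (hxyz : {x, y, z} = e) :
      ∃ v a b, (a, b) ∈ oddPairs k ∧ apexTriangle k (v, a, b) = e :=
    ⟨x, a, b, hab, by simp [apexTriangle, hy, hz, hxyz]⟩
  have mono (c : ZMod 2) (hc : ∀ x ∈ e, parity k x = c) : False := by
    obtain ⟨u, hu, hu0⟩ := h0
    obtain ⟨w, hw, hw1⟩ := h1
    exact zero_ne_one (hu0.symm.trans ((hc u hu).trans ((hc w hw).symm.trans hw1)))
  obtain ⟨t, rfl | rfl | rfl | rfl | ⟨i, hi, rfl | rfl⟩⟩ := mem_Lk.1 hF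
  · rcases eq_triple_of_subset he heF with rfl | rfl | rfl | rfl
    · exact key (t + 1) (t + 2) t 1 (13 + 4 * k) (mem_oddPairs.2 (by omega))
        (by grind) (by grind) (by grind)
    · exact key t (t + 1) (t + 3) 1 3 (mem_oddPairs.2 (by omega))
        (by grind) (by grind) (by grind)
    · exact key (t + 3) t (t + 2) (11 + 4 * k) (13 + 4 * k) (mem_oddPairs.2 (by omega))
        (by grind) (by grind) (by grind)
    · exact key (t + 2) (t + 3) (t + 1) 1 (13 + 4 * k) (mem_oddPairs.2 (by omega))
        (by grind) (by grind) (by grind)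
  · rcases eq_triple_of_subset he heF with rfl | rfl | rfl | rfl
    · exact key t (t + 1) (t + 3) 1 3 (mem_oddPairs.2 (by omega))
        (by grind) (by grind) (by grind)
    · exact key t (t + 1) (t + 7) 1 7 (mem_oddPairs.2 (by omega))
        (by grind) (by grind) (by grind)
    · exact key t (t + 3) (t + 7) 3 7 (mem_oddPairs.2 (by omega))
        (by grind) (by grind) (by grind)
    · exact (mono (parity k t + 1) (by simp [
        parity_ofNat_of_odd (k := k) (a := 3) rfl, parity_ofNat_of_odd (k := k) (a := 7) rfl])).elim
  · rcases eq_triple_of_subset he heF with rfl | rfl | rfl | rfl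
    · exact key t (t + 1) (t + 5) 1 5 (mem_oddPairs.2 (by omega))
        (by grind) (by grind) (by grind)
    · exact key t (t + 1) (t + 7) 1 7 (mem_oddPairs.2 (by omega))
        (by grind) (by grind) (by grind)
    · exact key t (t + 5) (t + 7) 5 7 (mem_oddPairs.2 (by simp))
        (by grind) (by grind) (by grind)
    · exact (mono (parity k t + 1) (by simp [
        parity_ofNat_of_odd (k := k) (a := 5) rfl, parity_ofNat_of_odd (k := k) (a := 7) rfl])).elim
  · rcases eq_triple_of_subset he heF with rfl | rfl | rfl | rfl
    · exact key t (t + 1) (t + 5) 1 5 (mem_oddPairs.2 (by omega))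
        (by grind) (by grind) (by grind)
    · exact key (t + 1) (t - 2) t (11 + 4 * k) (13 + 4 * k) (mem_oddPairs.2 (by omega))
        (by grind) (by grind) (by grind)
    · exact key (t + 5) (t - 2) t (5 + 2 * (2 * k + 1)) (7 + 2 * (2 * k + 1))
        (mem_oddPairs.2 (by simp)) (by grind) (by grind) (by grind)
    · exact key (t - 2) (t + 1) (t + 5) 3 7 (mem_oddPairs.2 (by omega))
        (by grind) (by grind) (by grind)
  · obtain ⟨m, hm⟩ : ∃ m, i + m = 2 * k := ⟨2 * k - i, by omega⟩
    have hm' : (i + m : ZMod (14 + 4 * k)) = 2 * k := by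
      exact_mod_cast congrArg (Nat.cast (R := ZMod (14 + 4 * k))) hm
    have hfam (j : ℕ) (hj : j < 2 * k + 2) : (5 + 2 * j, 7 + 2 * j) ∈ oddPairs k :=
      mem_oddPairs.2 <| by
        iterate 6 right
        exact ⟨j, hj, rfl, rfl⟩
    rcases eq_triple_of_subset he heF with rfl | rfl | rfl | rfl
    · exact key (t + 7 + 2 * i) t (t + 2) _ _ (hfam (m + 1) (by omega))
        (by grind) (by grind) (by grind)
    · exact key (t + 9 + 2 * i) t (t + 2) _ _ (hfam m (by omega))
        (by grind) (by grind) (by grind)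
    · exact key t (t + 7 + 2 * i) (t + 9 + 2 * i) _ _ (hfam (i + 1) (by omega))
        (by grind) (by grind) (by grind)
    · exact key (t + 2) (t + 7 + 2 * i) (t + 9 + 2 * i) _ _ (hfam i (by omega))
        (by grind) (by grind) (by grind)
  · have hmono : ∀ x ∈ ({t, t + 4, t + 6 + 2 * i, t + 10 + 2 * i} : Finset (ZMod (14 + 4 * k))),
        parity k x = parity k t := by
      simp [parity_ofNat_of_even (k := k) (a := 2) rfl, parity_ofNat_of_even (k := k) (a := 4) rfl,
        parity_ofNat_of_even (k := k) (a := 6) rfl, parity_ofNat_of_even (k := k) (a := 10) rfl]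
    exact (mono (parity k t) fun x hx => hmono x (heF hx)).elim

lemma eq_apex_of_parity_eq {k a b : ℕ} {v u : ZMod (14 + 4 * k)} (hab : (a, b) ∈ oddPairs k)
    (hu : u ∈ apexTriangle k (v, a, b)) (hp : parity k u = parity k v) : u = v := by
  obtain ⟨ha, hb, -, -⟩ := oddPairs_spec hab
  have pa := parity_natCast_of_odd (k := k) ha
  have pb := parity_natCast_of_odd (k := k) hb
  simp only [apexTriangle, Finset.mem_insert, Finset.mem_singleton] at hu
  rcases hu with rfl | rfl | rfl
  · rfl
  · rw [map_add, pa] at hp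
    simp at hp
  · rw [map_add, pb] at hp
    simp at hp

lemma apexTriangle_injOn (k : ℕ) :
    Set.InjOn (apexTriangle k) {q | q.2 ∈ oddPairs k} := by
  rintro ⟨v, a, b⟩ (hp : (a, b) ∈ oddPairs k) ⟨v', a', b'⟩ (hp' : (a', b') ∈ oddPairs k) h
  obtain ⟨ha, hb, hab, hbn⟩ := oddPairs_spec hp
  obtain ⟨ha', hb', hab', hbn'⟩ := oddPairs_spec hp'
  have pa := parity_natCast_of_odd (k := k) ha
  have pb := parity_natCast_of_odd (k := k) hb
  have pa' := parity_natCast_of_odd (k := k) ha'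
  have pb' := parity_natCast_of_odd (k := k) hb'
  have cancel {c d : ℕ} (hc : c < 14 + 4 * k) (hd : d < 14 + 4 * k)
      (hcd : v + (c : ZMod (14 + 4 * k)) = v + d) : c = d :=
    natCast_inj_of_lt hc hd (add_left_cancel hcd)
  have hv : v = v' := by
    by_cases hvv : parity k v = parity k v'
    · exact eq_apex_of_parity_eq hp' (h ▸ by simp [apexTriangle]) hvv
    · have hvv' : parity k v' + 1 = parity k v := by
        generalize parity k v = x at *
        generalize parity k v' = y at *
        revert x y
        decide
      have ea : v' + a' = v :=
        eq_apex_of_parity_eq hp (h ▸ by simp [apexTriangle]) (by rw [map_add, pa', hvv'])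
      have eb : v' + b' = v :=
        eq_apex_of_parity_eq hp (h ▸ by simp [apexTriangle]) (by rw [map_add, pb', hvv'])
      have := natCast_inj_of_lt (by omega) hbn' (add_left_cancel (ea.trans eb.symm))
      omega
  subst hv
  have mem {c : ℕ} (hc : c < 14 + 4 * k) (hc1 : c % 2 = 1)
      (hm : v + (c : ZMod (14 + 4 * k)) ∈ apexTriangle k (v, a', b')) : c = a' ∨ c = b' := by
    simp only [apexTriangle, Finset.mem_insert, Finset.mem_singleton] at hm
    rcases hm with hm | hm | hm
    · have := congrArg (parity k) hm
      rw [map_add, parity_natCast_of_odd hc1] at this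
      simp at this
    · exact Or.inl (cancel hc (by omega) hm)
    · exact Or.inr (cancel hc hbn' hm)
  have h1 := mem (by omega) ha (h ▸ by simp [apexTriangle])
  have h2 := mem hbn hb (h ▸ by simp [apexTriangle])
  obtain ⟨rfl, rfl⟩ : a = a' ∧ b = b' := by omega
  rfl

lemma card_apexTriangle {k a b : ℕ} (v : ZMod (14 + 4 * k)) (hab : (a, b) ∈ oddPairs k) :
    (apexTriangle k (v, a, b)).card = 3 := by
  obtain ⟨ha, hb, hlt, hbn⟩ := oddPairs_spec hab
  have pa := parity_natCast_of_odd (k := k) ha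
  have pb := parity_natCast_of_odd (k := k) hb
  refine Finset.card_eq_three.2 ⟨v, v + a, v + b, fun h => ?_, fun h => ?_, fun h => ?_, rfl⟩
  · simpa [pa] using congrArg (parity k) h
  · simpa [pb] using congrArg (parity k) h
  · have := natCast_inj_of_lt (by omega) hbn (add_left_cancel h)
    omega

/-- The triangles of `L_k` with vertices of both parities are the sets `{v, v + a, v + b}`. -/
lemma mixed_triangles_eq_image (k : ℕ) :
    {e : Finset (ZMod (14 + 4 * k)) | e.card = 3 ∧ (∃ u ∈ e, u.val % 2 = 0) ∧
        (∃ w ∈ e, w.val % 2 = 1) ∧ ∃ F ∈ Lk k, e ⊆ F} =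
      apexTriangle k '' (Set.univ ×ˢ (oddPairs k : Set (ℕ × ℕ))) := by
  ext e
  simp only [← parity_eq_zero, ← parity_eq_one]
  constructor
  · rintro ⟨he, h0, h1, F, hF, heF⟩
    obtain ⟨v, a, b, hab, rfl⟩ := exists_apexTriangle he h0 h1 hF heF
    exact ⟨(v, a, b), ⟨trivial, hab⟩, rfl⟩
  · rintro ⟨⟨v, a, b⟩, ⟨-, hab⟩, rfl⟩
    have pa := parity_natCast_of_odd (k := k) (oddPairs_spec hab).1
    have hv : v ∈ apexTriangle k (v, a, b) := by simp [apexTriangle]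
    have hva : v + a ∈ apexTriangle k (v, a, b) := by simp [apexTriangle]
    have hpa : parity k (v + a) = parity k v + 1 := by rw [map_add, pa]
    refine ⟨card_apexTriangle v hab, ?_, ?_, apexTriangle_subset_facet v hab⟩
    all_goals
      obtain hp | hp : parity k v = 0 ∨ parity k v = 1 := by
        generalize parity k v = x
        revert x
        decide
    · exact ⟨v, hv, hp⟩
    · exact ⟨v + a, hva, by rw [hpa, hp]; rfl⟩
    · exact ⟨v + a, hva, by rw [hpa, hp]; rfl⟩
    · exact ⟨v, hv, hp⟩

/-- The edge joining the `i`-th even to the `j`-th odd residue. -/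
def mixedEdge (k : ℕ) (p : ℕ × ℕ) : Finset (ZMod (14 + 4 * k)) :=
  {((2 * p.1 : ℕ) : ZMod (14 + 4 * k)), ((2 * p.2 + 1 : ℕ) : ZMod (14 + 4 * k))}

lemma mixedEdge_subset_facet {k : ℕ} {u w : ZMod (14 + 4 * k)} (hu : parity k u = 0)
    (hw : parity k w = 1) : ∃ F ∈ Lk k, {u, w} ⊆ F := by
  have : NeZero (14 + 4 * k) := ⟨by omega⟩
  have hd : (w - u).val % 2 = 1 := by
    rw [← parity_eq_one, map_sub, hu, hw, sub_zero]
  obtain ⟨a, b, hab, hdab⟩ := exists_oddPairs hd (ZMod.val_lt _)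
  obtain ⟨F, hF, h⟩ := apexTriangle_subset_facet u hab
  refine ⟨F, hF, subset_trans ?_ h⟩
  have hw' : w = u + ((w - u).val : ℕ) := by simp
  simp only [apexTriangle, Finset.insert_subset_iff, Finset.singleton_subset_iff,
    Finset.mem_insert, Finset.mem_singleton, true_or, true_and]
  rcases hdab with h | h <;> rw [h] at hw' <;> simp [← hw']

lemma mixedEdge_injOn (k : ℕ) :
    Set.InjOn (mixedEdge k) (Finset.range (7 + 2 * k) ×ˢ Finset.range (7 + 2 * k) :) := by
  rintro ⟨i, j⟩ hp ⟨i', j'⟩ hp' h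
  simp only [Finset.coe_product, Finset.coe_range, Set.mem_prod, Set.mem_Iio] at hp hp'
  have mem {c : ℕ} (hc : c < 14 + 4 * k) (hm : (c : ZMod (14 + 4 * k)) ∈ mixedEdge k (i', j')) :
      c = 2 * i' ∨ c = 2 * j' + 1 := by
    simp only [mixedEdge, Finset.mem_insert, Finset.mem_singleton] at hm
    exact hm.imp (natCast_inj_of_lt hc (by omega)) (natCast_inj_of_lt hc (by omega))
  have h1 := mem (c := 2 * i) (by omega) (h ▸ by simp [mixedEdge])
  have h2 := mem (c := 2 * j + 1) (by omega) (h ▸ by simp [mixedEdge])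
  rw [Prod.mk.injEq]
  omega

/-- Every pair of residues of opposite parity is an edge of `L_k`. -/
lemma mixed_edges_eq_image (k : ℕ) :
    {e : Finset (ZMod (14 + 4 * k)) | e.card = 2 ∧ (∃ u ∈ e, u.val % 2 = 0) ∧
        (∃ w ∈ e, w.val % 2 = 1) ∧ ∃ F ∈ Lk k, e ⊆ F} =
      mixedEdge k '' (Finset.range (7 + 2 * k) ×ˢ Finset.range (7 + 2 * k) :) := by
  have : NeZero (14 + 4 * k) := ⟨by omega⟩
  ext e
  constructor
  · rintro ⟨he, ⟨u, hu, hu0⟩, ⟨w, hw, hw1⟩, -⟩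
    have hul := ZMod.val_lt u
    have hwl := ZMod.val_lt w
    refine ⟨(u.val / 2, w.val / 2), ?_, ?_⟩
    · simp only [Finset.coe_product, Finset.coe_range, Set.mem_prod, Set.mem_Iio]
      omega
    · have huw : u ≠ w := by
        rintro rfl
        omega
      have h1 : 2 * (u.val / 2) = u.val := by omega
      have h2 : 2 * (w.val / 2) + 1 = w.val := by omega
      rw [mixedEdge, h1, h2, ZMod.natCast_zmod_val, ZMod.natCast_zmod_val]
      refine Finset.eq_of_subset_of_card_le ?_ ?_
      · simp [Finset.insert_subset_iff, hu, hw]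
      · rw [he, Finset.card_pair huw]
  · rintro ⟨⟨i, j⟩, -, rfl⟩
    have hi : parity k ((2 * i : ℕ) : ZMod (14 + 4 * k)) = 0 :=
      parity_natCast_of_even (by omega)
    have hj : parity k ((2 * j + 1 : ℕ) : ZMod (14 + 4 * k)) = 1 :=
      parity_natCast_of_odd (by omega)
    refine ⟨Finset.card_pair fun h => ?_, ⟨_, Finset.mem_insert_self _ _, parity_eq_zero.1 hi⟩,
      ⟨_, Finset.mem_insert_of_mem (Finset.mem_singleton_self _), parity_eq_one.1 hj⟩,
      mixedEdge_subset_facet hi hj⟩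
    exact zero_ne_one (hi.symm.trans ((congrArg (parity k) h).trans hj))

/-- The slicing of `L_k` between the even and the odd vertices has `4k² + 28k + 49`
vertices (mixed-parity edges of `L_k`) and `8k² + 60k + 112` edges (mixed-parity
triangles of `L_k`). -/
theorem Lk_slicing_face_counts (k : ℕ) :
    {e : Finset (ZMod (14 + 4 * k)) | e.card = 2 ∧ (∃ u ∈ e, u.val % 2 = 0) ∧
        (∃ w ∈ e, w.val % 2 = 1) ∧ ∃ F ∈ Lk k, e ⊆ F}.ncard
      = 4 * k ^ 2 + 28 * k + 49 ∧
    {e : Finset (ZMod (14 + 4 * k)) | e.card = 3 ∧ (∃ u ∈ e, u.val % 2 = 0) ∧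
        (∃ w ∈ e, w.val % 2 = 1) ∧ ∃ F ∈ Lk k, e ⊆ F}.ncard
      = 8 * k ^ 2 + 60 * k + 112 := by
  constructor
  · rw [mixed_edges_eq_image, (mixedEdge_injOn k).ncard_image, Set.ncard_coe_finset,
      Finset.card_product, Finset.card_range]
    ring
  · have hinj := (apexTriangle_injOn k).mono
      (show (Set.univ ×ˢ (oddPairs k : Set (ℕ × ℕ))) ⊆ {q | q.2 ∈ oddPairs k} from
        fun q hq => hq.2)
    rw [mixed_triangles_eq_image, hinj.ncard_image, Set.ncard_prod, Set.ncard_univ, Nat.card_zmod,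
      Set.ncard_coe_finset, card_oddPairs]
    ring
end

section
/- Fix k ≥ 0. On ZMod (2k+7), multiplication by the unit k+4 (which is the inverse of 2 modulo 2k+7) maps the difference cycle (2 : 2 : 2 : 2k+1) bijectively onto the difference cycle (1 : 1 : 1 : 2k+4); in particular the two difference cycles are combinatorially isomorphic simplicial complexes. -/
theorem image_mul_repSet {n d : ℕ} {a b : ℕ → ℕ} {u : ZMod n}
    (h : ∀ j < d, u * (a j : ZMod n) = b j) :
    (repSet n d a).image (fun x => u * x) = repSet n d b := by
  unfold repSet
  rw [Finset.image_image]
  refine Finset.image_congr fun j hj => ?_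
  have hj' : j < d + 1 := by simpa using hj
  simp only [Function.comp_apply, Nat.cast_sum, Finset.mul_sum]
  exact Finset.sum_congr rfl fun i hi => h i (by have := Finset.mem_range.mp hi; omega)

/-- Multiplication by a unit that carries the first `d` differences of one cycle to those of
another is a bijection between the two difference cycles. -/
theorem bijOn_image_mul_diffCycle {n d : ℕ} {a b : ℕ → ℕ} {u v : ZMod n} (huv : u * v = 1)
    (h : ∀ j < d, u * (a j : ZMod n) = b j) :
    Set.BijOn (fun F : Finset (ZMod n) => F.image fun x => u * x)
      (diffCycle n d a) (diffCycle n d b) := by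
  have translate (t : ZMod n) :
      ((repSet n d a).image fun x => t + x).image (fun x => u * x) =
        (repSet n d b).image fun x => u * t + x := by
    rw [← image_mul_repSet h, Finset.image_image, Finset.image_image]
    exact Finset.image_congr fun x _ => mul_add u t x
  refine ⟨?_, ?_, ?_⟩
  · rintro _ ⟨t, rfl⟩
    exact ⟨u * t, translate t⟩
  · refine (Finset.image_injective fun x y hxy => ?_).injOn
    exact (IsUnit.of_mul_eq_one v huv).mul_left_cancel hxy
  · rintro _ ⟨t, rfl⟩
    refine ⟨_, ⟨v * t, rfl⟩, ?_⟩
    simp only [translate, ← mul_assoc, huv, one_mul]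

/-- On `ZMod (2k+7)`, multiplication by `k + 4` (the inverse of `2`) maps the difference
cycle `(2 : 2 : 2 : 2k+1)` bijectively onto the difference cycle `(1 : 1 : 1 : 2k+4)`; in
particular the two difference cycles are combinatorially isomorphic. -/
theorem dc_2221_iso_111 (k : ℕ) :
    ((k + 4 : ZMod (2 * k + 7)) * 2 = 1) ∧
    Set.BijOn
      (fun F : Finset (ZMod (2 * k + 7)) =>
        F.image fun x => (k + 4 : ZMod (2 * k + 7)) * x)
      (dc4 (2 * k + 7) 2 2 2 (2 * k + 1))
      (dc4 (2 * k + 7) 1 1 1 (2 * k + 4)) := by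
  have half : (k + 4 : ZMod (2 * k + 7)) * 2 = 1 := by
    have hn : ((2 * k + 7 : ℕ) : ZMod (2 * k + 7)) = 0 := ZMod.natCast_self _
    push_cast at hn
    linear_combination hn
  refine ⟨half, bijOn_image_mul_diffCycle half fun j hj => ?_⟩
  interval_cases j <;> simpa using half
end

section
/- Fix k ≥ 0 and set n = 14+4k. The map ZMod (7+2k) → ZMod (14+4k), x ↦ 2x, applied elementwise to finsets, maps the union of difference cycles ⋃_{i=0}^{k} (2 : 1+i : 2 : 2+2k−i) on 7+2k vertices bijectively onto the set of facets of ⋃_{i=0}^{k} (4 : 2+2i : 4 : 4+4k−2i) ⊆ L_k all of whose vertices are even; in particular the subcomplex of L_k spanned by the even vertices is simplicially isomorphic to ⋃_{i=0}^{k} (2 : 1+i : 2 : 2+2k−i). -/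
/-- Doubling representatives sends the class of `a` modulo `m` to the class of `2 * a`
modulo `2 * m`. -/
theorem double_natCast {m n : ℕ} (hn : n = 2 * m) (a : ℕ) :
    ((2 * (a : ZMod m).val : ℕ) : ZMod n) = ((2 * a : ℕ) : ZMod n) := by
  subst hn
  rw [ZMod.natCast_eq_natCast_iff, ZMod.val_natCast]
  exact (Nat.mod_modEq a m).mul_left' 2

theorem double_add {m n : ℕ} [NeZero m] (hn : n = 2 * m) (x y : ZMod m) :
    ((2 * (x + y).val : ℕ) : ZMod n) = ((2 * x.val : ℕ) : ZMod n) + ((2 * y.val : ℕ) : ZMod n) := by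
  have h := double_natCast hn (x.val + y.val)
  rw [Nat.cast_add, ZMod.natCast_zmod_val, ZMod.natCast_zmod_val] at h
  rw [h, mul_add, Nat.cast_add]

theorem val_double {m n : ℕ} [NeZero m] (hn : n = 2 * m) (x : ZMod m) :
    ((2 * x.val : ℕ) : ZMod n).val = 2 * x.val := by
  have := ZMod.val_lt x
  exact ZMod.val_natCast_of_lt (by omega)

theorem double_injective {m n : ℕ} [NeZero m] (hn : n = 2 * m) :
    Function.Injective fun x : ZMod m => ((2 * x.val : ℕ) : ZMod n) := by
  intro x y h
  have h' := congrArg ZMod.val h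
  simp only [val_double hn] at h'
  exact ZMod.val_injective m (by omega)

theorem exists_double_eq {m n : ℕ} [NeZero n] (hn : n = 2 * m) {t : ZMod n}
    (ht : t.val % 2 = 0) : ∃ s : ZMod m, ((2 * s.val : ℕ) : ZMod n) = t := by
  refine ⟨(t.val / 2 : ℕ), ?_⟩
  rw [double_natCast hn, show 2 * (t.val / 2) = t.val by omega, ZMod.natCast_zmod_val]

theorem image_double_repSet {m n : ℕ} (hn : n = 2 * m) (d : ℕ) (a : ℕ → ℕ) :
    (repSet m d a).image (fun x => ((2 * x.val : ℕ) : ZMod n)) =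
      repSet n d fun j => 2 * a j := by
  rw [repSet, repSet, Finset.image_image]
  refine Finset.image_congr fun j _ => ?_
  rw [Function.comp_apply, double_natCast hn, Finset.mul_sum]

theorem image_double_translate_repSet {m n : ℕ} [NeZero m] (hn : n = 2 * m) (d : ℕ) (a : ℕ → ℕ)
    (t : ZMod m) :
    ((repSet m d a).image fun x => t + x).image (fun x => ((2 * x.val : ℕ) : ZMod n)) =
      (repSet n d fun j => 2 * a j).image fun x => ((2 * t.val : ℕ) : ZMod n) + x := by
  rw [← image_double_repSet hn, Finset.image_image, Finset.image_image]
  exact Finset.image_congr fun x _ => double_add hn t x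

theorem zero_mem_repSet (n d : ℕ) (a : ℕ → ℕ) : (0 : ZMod n) ∈ repSet n d a :=
  Finset.mem_image.2 ⟨0, by simp, by simp⟩

/-- Doubling maps a difference cycle onto the facets of the doubled difference cycle whose
vertices are all even. -/
theorem image_double_diffCycle {m n : ℕ} [NeZero m] (hn : n = 2 * m) (d : ℕ) (a : ℕ → ℕ) :
    (fun F : Finset (ZMod m) => F.image fun x => ((2 * x.val : ℕ) : ZMod n)) '' diffCycle m d a =
      {F | F ∈ diffCycle n d (fun j => 2 * a j) ∧ ∀ v ∈ F, v.val % 2 = 0} := by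
  have : NeZero n := ⟨by have := NeZero.ne m; omega⟩
  ext G
  constructor
  · rintro ⟨F, ⟨t, rfl⟩, rfl⟩
    refine ⟨⟨_, image_double_translate_repSet hn d a t⟩, fun v hv => ?_⟩
    obtain ⟨x, -, rfl⟩ := Finset.mem_image.1 hv
    rw [val_double hn, Nat.mul_mod_right]
  · rintro ⟨⟨t, rfl⟩, ht⟩
    obtain ⟨s, rfl⟩ := exists_double_eq hn
      (ht t (Finset.mem_image.2 ⟨0, zero_mem_repSet n d _, add_zero t⟩))
    exact ⟨_, ⟨s, rfl⟩, image_double_translate_repSet hn d a s⟩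

theorem image_double_dc4 {m n : ℕ} [NeZero m] (hn : n = 2 * m) (b0 b1 b2 b3 : ℕ) :
    (fun F : Finset (ZMod m) => F.image fun x => ((2 * x.val : ℕ) : ZMod n)) ''
        dc4 m b0 b1 b2 b3 =
      {F | F ∈ dc4 n (2 * b0) (2 * b1) (2 * b2) (2 * b3) ∧ ∀ v ∈ F, v.val % 2 = 0} := by
  simp only [dc4, image_double_diffCycle hn, mul_ite]

/-- The doubling map `ZMod (7+2k) → ZMod (14+4k)`, `x ↦ 2x`, maps the union of the
difference cycles `(2 : 1+i : 2 : 2+2k-i)`, `0 ≤ i ≤ k`, bijectively onto the set of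
facets of `⋃ᵢ (4 : 2+2i : 4 : 4+4k-2i) ⊆ L_k` all of whose vertices are even; in
particular the subcomplex of `L_k` spanned by the even vertices is simplicially
isomorphic to `⋃ᵢ (2 : 1+i : 2 : 2+2k-i)`. -/
theorem Lk_even_subcomplex (k : ℕ) :
    Set.BijOn
      (fun F : Finset (ZMod (7 + 2 * k)) =>
        F.image fun x => ((2 * x.val : ℕ) : ZMod (14 + 4 * k)))
      (⋃ i ∈ Finset.range (k + 1), dc4 (7 + 2 * k) 2 (1 + i) 2 (2 + 2 * k - i))
      {F | (F ∈ ⋃ i ∈ Finset.range (k + 1),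
              dc4 (14 + 4 * k) 4 (2 + 2 * i) 4 (4 + 4 * k - 2 * i)) ∧
           ∀ v ∈ F, v.val % 2 = 0} := by
  have hn : 14 + 4 * k = 2 * (7 + 2 * k) := by ring
  have : NeZero (7 + 2 * k) := ⟨by omega⟩
  have hinj := Finset.image_injective (double_injective hn)
  convert hinj.injOn.bijOn_image using 1
  simp only [Set.image_iUnion, image_double_dc4 hn]
  ext F
  have h (i : ℕ) : 2 * (2 + 2 * k - i) = 4 + 4 * k - 2 * i := by omega
  simp only [h, Nat.reduceMul, mul_add, mul_one, Set.mem_iUnion, Set.mem_ofPred_eq]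
  tauto
end
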